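/- arXiv:2007.07240 — 2 statements merged into one kernel-verified Lean document; each statement's English description precedes it below -/
import Mathlib

section
/- For integers n ≥ m ≥ 1, the 2-color Ramsey number of the graph K_{1,n} ∪ K_{1,m} (disjoint union of two stars) versus itself equals max{n+2m, 2n+1, n+m+3}. That is, every red-blue edge-coloring of the complete graph on max{n+2m, 2n+1, n+m+3} vertices contains a monochromatic copy of K_{1,n} ∪ K_{1,m}, and there is a red-blue coloring of the complete graph on max{n+2m, 2n+1, n+m+3} − 1 vertices with no monochromatic K_{1,n} ∪ K_{1,m}. -/
open Finset

/-- A symmetric edge-coloring of a complete graph (given as a function on ordered pairs). -/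
def IsSymm2 {V C : Type*} (c : V → V → C) : Prop := ∀ a b : V, c a b = c b a

/-- The coloring contains a rainbow triangle: three vertices whose three pairwise
edges receive three distinct colors. -/
def HasRainbowTriangle {V C : Type*} (c : V → V → C) : Prop :=
  ∃ a b d : V, a ≠ b ∧ a ≠ d ∧ b ≠ d ∧
    c a b ≠ c a d ∧ c a b ≠ c b d ∧ c a d ≠ c b d

/-- The coloring contains a monochromatic star `K_{1,n}`: a center `v` with `n`
incident edges of a single color. -/
def HasMonoStar {V C : Type*} (c : V → V → C) (n : ℕ) : Prop :=
  ∃ (i : C) (v : V) (S : Finset V), S.card = n ∧ v ∉ S ∧ ∀ x ∈ S, c v x = i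

/-- The coloring contains a monochromatic copy of `K_{1,n} ∪ K_{1,m}`: two
vertex-disjoint stars of the same color with `n` and `m` leaves respectively. -/
def HasMonoTwoStars {V C : Type*} (c : V → V → C) (n m : ℕ) : Prop :=
  ∃ (i : C) (u v : V) (S T : Finset V), u ≠ v ∧ S.card = n ∧ T.card = m ∧
    Disjoint S T ∧ u ∉ S ∧ u ∉ T ∧ v ∉ S ∧ v ∉ T ∧
    (∀ x ∈ S, c u x = i) ∧ (∀ y ∈ T, c v y = i)


namespace UStars

/-- Neighbours of `v` in color `i`. -/
def nb {V : Type*} [Fintype V] [DecidableEq V] (c : V → V → Fin 2) (i : Fin 2) (v : V) : Finset V :=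
  univ.filter fun x => x ≠ v ∧ c v x = i

/-- A coloring without two stars. -/
structure Ctx {V : Type*} [Fintype V] (c : V → V → Fin 2) (n m k : ℕ) : Prop where
  symm : IsSymm2 c
  no : ¬ HasMonoTwoStars c n m
  card : Fintype.card V = n + m + 1 + k
  hm : 1 ≤ m
  hmn : m ≤ n
  k2 : 2 ≤ k
  hmk : m ≤ k + 1
  nk : n ≤ m + k

section
variable {V : Type*} [Fintype V] [DecidableEq V] {c : V → V → Fin 2} {n m k : ℕ}

lemma mem_nb {i : Fin 2} {v x : V} : x ∈ nb c i v ↔ x ≠ v ∧ c v x = i := by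
  simp [nb]

lemma nb_comm (hs : IsSymm2 c) {i : Fin 2} {v x : V} : x ∈ nb c i v ↔ v ∈ nb c i x := by
  rw [mem_nb, mem_nb, hs v x, ne_comm]

lemma not_self {i : Fin 2} {v : V} : v ∉ nb c i v := by simp [mem_nb]

lemma col {i j : Fin 2} (h : i ≠ j) (x : Fin 2) : x = i ∨ x = j := by omega

lemma nb_or {i j : Fin 2} (h : i ≠ j) {v x : V} (hx : x ≠ v) : x ∈ nb c i v ∨ x ∈ nb c j v := by
  simp only [mem_nb]; rcases col h (c v x) with h | h <;> simp [h, hx]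

lemma nb_not {i j : Fin 2} (h : i ≠ j) {v x : V} (hx : x ∈ nb c i v) : x ∉ nb c j v := by
  simp only [mem_nb] at *; rintro ⟨_, h2⟩; exact h (hx.2.symm.trans h2)

lemma deg_add {i j : Fin 2} (h : i ≠ j) (v : V) :
    (nb c i v).card + (nb c j v).card + 1 = Fintype.card V := by
  have hd : Disjoint (nb c i v) (nb c j v) :=
    Finset.disjoint_left.2 fun x hx => nb_not h hx
  have hu : nb c i v ∪ nb c j v = univ.erase v := by
    ext x
    simp only [mem_union, mem_erase, mem_univ, and_true]
    constructor
    · rintro (h | h) <;> exact (mem_nb.1 h).1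
    · exact nb_or h
  rw [← card_union_of_disjoint hd, hu, card_erase_of_mem (mem_univ _), card_univ]
  have : 0 < Fintype.card V := Fintype.card_pos_iff.2 ⟨v⟩
  omega

lemma erase_add {i j : Fin 2} (h : i ≠ j) {u v : V} (huv : u ≠ v) :
    ((nb c i v).erase u).card + ((nb c j v).erase u).card + 2 = Fintype.card V := by
  have h0 := deg_add (c := c) h v
  rcases nb_or (c := c) h huv with h1 | h1
  · have h2 := nb_not h h1
    rw [erase_eq_of_notMem h2]
    have := card_erase_add_one h1
    omega
  · have h2 := nb_not h.symm h1
    rw [erase_eq_of_notMem h2]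
    have := card_erase_add_one h1
    omega

lemma pick {A B : Finset V} {n m : ℕ} (hA : n ≤ A.card) (hB : m ≤ B.card)
    (hAB : n + m ≤ (A ∪ B).card) :
    ∃ S T : Finset V, S ⊆ A ∧ T ⊆ B ∧ Disjoint S T ∧ S.card = n ∧ T.card = m := by
  by_cases h : m ≤ (B \ A).card
  · obtain ⟨T, hT, hTc⟩ := exists_subset_card_eq h
    obtain ⟨S, hS, hSc⟩ := exists_subset_card_eq hA
    refine ⟨S, T, hS, hT.trans sdiff_subset, ?_, hSc, hTc⟩
    exact Finset.disjoint_left.2 fun x hx hx' => (mem_sdiff.1 (hT hx')).2 (hS hx)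
  · obtain ⟨T, hT1, hT2, hTc⟩ := exists_subsuperset_card_eq (sdiff_subset (s := B) (t := A))
      (by omega) hB
    have h1 : A ∪ B ⊆ (A \ T) ∪ T := by
      intro x hx
      simp only [mem_union, mem_sdiff] at *
      by_cases hxT : x ∈ T
      · exact Or.inr hxT
      · refine Or.inl ⟨?_, hxT⟩
        by_contra hxA
        exact hxT (hT1 (mem_sdiff.2 ⟨hx.resolve_left hxA, hxA⟩))
    have h2 := (card_le_card h1).trans (card_union_le _ _)
    obtain ⟨S, hS, hSc⟩ := exists_subset_card_eq (show n ≤ (A \ T).card by omega)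
    refine ⟨S, T, hS.trans sdiff_subset, hT2, ?_, hSc, hTc⟩
    exact Finset.disjoint_left.2 fun x hx hx' => (mem_sdiff.1 (hS hx)).2 hx'

/-- Main use of the absence of two stars. -/
lemma Ctx.key (H : Ctx c n m k) {i j : Fin 2} (hij : i ≠ j) {u v : V} (huv : u ≠ v)
    (hu : n ≤ ((nb c i u).erase v).card) (hv : m ≤ ((nb c i v).erase u).card) :
    k ≤ (nb c j u ∩ nb c j v).card := by
  by_contra hk
  apply H.no
  have hsub : (univ : Finset V) ⊆ ((((nb c i u).erase v) ∪ ((nb c i v).erase u)) ∪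
      (nb c j u ∩ nb c j v)) ∪ {u, v} := by
    intro x _
    by_cases hxu : x = u
    · simp [hxu]
    by_cases hxv : x = v
    · simp [hxv]
    have h1 := nb_or (c := c) hij hxu
    have h2 := nb_or (c := c) hij hxv
    simp only [mem_union, mem_erase, mem_inter]
    tauto
  have h1 := card_le_card hsub
  have h2 := card_union_le ((((nb c i u).erase v) ∪ ((nb c i v).erase u)) ∪
      (nb c j u ∩ nb c j v)) {u, v}
  have h3 := card_union_le (((nb c i u).erase v) ∪ ((nb c i v).erase u)) (nb c j u ∩ nb c j v)
  have h4 := card_le_two (a := u) (b := v)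
  rw [card_univ, H.card] at h1
  obtain ⟨S, T, hS, hT, hST, hSc, hTc⟩ := pick hu hv (by omega)
  refine ⟨i, u, v, S, T, huv, hSc, hTc, hST, ?_, ?_, ?_, ?_, ?_, ?_⟩
  · intro h; exact not_self (mem_of_mem_erase (hS h))
  · intro h; exact notMem_erase _ _ (hT h)
  · intro h; exact notMem_erase _ _ (hS h)
  · intro h; exact not_self (mem_of_mem_erase (hT h))
  · intro x hx; exact (mem_nb.1 (mem_of_mem_erase (hS hx))).2
  · intro x hx; exact (mem_nb.1 (mem_of_mem_erase (hT hx))).2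

lemma erase_le {i : Fin 2} {u v : V} : (nb c i u).card ≤ ((nb c i u).erase v).card + 1 := by
  have := pred_card_le_card_erase (s := nb c i u) (a := v); omega

lemma Ctx.P (H : Ctx c n m k) {i j : Fin 2} (hij : i ≠ j) {u w : V} (hw : w ≠ u)
    (hd : n + 1 ≤ (nb c i u).card) :
    k ≤ (nb c j u ∩ nb c j w).card ∨ n + k ≤ ((nb c j w).erase u).card := by
  by_contra! h
  have h1 := erase_add (c := c) hij hw.symm
  have h2 := erase_le (c := c) (i := i) (u := u) (v := w)
  have := H.key hij hw.symm (by omega) (by have := H.card; omega)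
  omega

lemma Ctx.Q (H : Ctx c n m k) {i j : Fin 2} (hij : i ≠ j) {w w' : V} (hw : w ≠ w')
    (hd : n + 1 ≤ (nb c j w).card) (hd' : m + 1 ≤ (nb c j w').card) :
    k ≤ (nb c i w ∩ nb c i w').card := by
  have h2 := erase_le (c := c) (i := j) (u := w) (v := w')
  have h3 := erase_le (c := c) (i := j) (u := w') (v := w)
  exact H.key hij.symm hw (by omega) (by omega)

lemma dc (hs : IsSymm2 c) (i : Fin 2) (A W : Finset V) :
    ∑ w ∈ W, (A ∩ nb c i w).card = ∑ a ∈ A, (W ∩ nb c i a).card := by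
  have h := sum_card_bipartiteAbove_eq_sum_card_bipartiteBelow (s := W) (t := A)
    (fun w a => a ∈ nb c i w)
  have e1 : ∀ w, A ∩ nb c i w = A.filter (fun a => a ∈ nb c i w) := by
    intro w; ext; simp
  have e2 : ∀ a, W ∩ nb c i a = W.filter (fun w => a ∈ nb c i w) := by
    intro a; ext x; simp only [mem_inter, mem_filter]; rw [nb_comm hs]
  simp only [e1, e2]
  exact h

/-- Case where the maximum degree is `n`. -/
lemma Ctx.caseA (H : Ctx c n m k) {i j : Fin 2} (hij : i ≠ j) {u : V}
    (hd : (nb c i u).card = n) (hmax : ∀ l v, (nb c l v).card ≤ n) : False := by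
  have hc := H.card
  have hk2 := H.k2
  have hmk := H.hmk
  have hnk := H.nk
  have hm := H.hm
  have hmn := H.hmn
  have hN : n = m + k := by
    have := deg_add (c := c) hij u
    have := hmax j u
    omega
  have hall : ∀ l v, (nb c l v).card = n := by
    intro l v
    have := hmax i v
    have := hmax j v
    have := deg_add (c := c) hij v
    rcases col hij l with h | h <;> subst h <;> omega
  have main : ∀ a b : Fin 2, a ≠ b → ∀ x ∈ nb c b u, (nb c a u ∩ nb c b x).card ≤ m - 1 := by
    intro a b hab x hx
    have hxu : x ≠ u := (mem_nb.1 hx).1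
    have hux := (nb_comm H.symm).1 hx
    have e1 : (nb c a u).erase x = nb c a u := erase_eq_of_notMem (nb_not hab.symm hx)
    have e2 : (nb c a x).erase u = nb c a x := erase_eq_of_notMem (nb_not hab.symm hux)
    have h1 := H.key hab hxu.symm (by rw [e1, hall]) (by rw [e2, hall]; omega)
    have hsub : (nb c b u ∩ nb c b x) ∪ (nb c a u ∩ nb c b x) ⊆ (nb c b x).erase u := by
      intro y hy
      simp only [mem_union, mem_inter, mem_erase] at *
      rcases hy with hy | hy
      · exact ⟨fun h => not_self (h ▸ hy.1), hy.2⟩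
      · exact ⟨fun h => not_self (h ▸ hy.1), hy.2⟩
    have hdis : Disjoint (nb c b u ∩ nb c b x) (nb c a u ∩ nb c b x) :=
      Finset.disjoint_left.2 fun y hy hy' =>
        nb_not hab (mem_inter.1 hy').1 (mem_inter.1 hy).1
    have h2 := card_le_card hsub
    rw [card_union_of_disjoint hdis, card_erase_of_mem hux, hall] at h2
    omega
  have s1 : ∑ b ∈ nb c j u, (nb c i u ∩ nb c j b).card ≤ n * (m - 1) := by
    have := sum_le_card_nsmul (nb c j u) _ _ (main i j hij)
    rwa [hall, smul_eq_mul] at this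
  have s2 : ∑ b ∈ nb c i u, (nb c j u ∩ nb c i b).card ≤ n * (m - 1) := by
    have := sum_le_card_nsmul (nb c i u) _ _ (main j i hij.symm)
    rwa [hall, smul_eq_mul] at this
  rw [dc H.symm] at s2
  have s3 : ∑ b ∈ nb c j u, ((nb c i u ∩ nb c j b).card + (nb c i u ∩ nb c i b).card) = n * n := by
    rw [← smul_eq_mul]
    nth_rw 1 [← hall j u]
    rw [← sum_const]
    refine sum_congr rfl fun b hb => ?_
    have hdis : Disjoint (nb c i u ∩ nb c j b) (nb c i u ∩ nb c i b) :=
      Finset.disjoint_left.2 fun y hy hy' =>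
        nb_not hij (mem_inter.1 hy').2 (mem_inter.1 hy).2
    rw [← card_union_of_disjoint hdis, ← inter_union_distrib_left, inter_eq_left.2, hall]
    intro y hy
    have : y ≠ b := fun h => nb_not hij hy (h ▸ hb)
    rw [union_comm]
    exact mem_union.2 (nb_or hij this)
  rw [sum_add_distrib] at s3
  have : n * n ≤ n * (2 * (m - 1)) := by
    have : n * (2 * (m-1)) = n * (m - 1) + n * (m - 1) := by ring
    omega
  have := Nat.le_of_mul_le_mul_left this (by omega)
  omega

lemma Ctx.case1 (H : Ctx c n m k) {i j : Fin 2} (hij : i ≠ j) {u : V}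
    (hd : n + m + 1 ≤ (nb c i u).card) : False := by
  have hc := H.card
  have hk2 := H.k2
  have hmk := H.hmk
  have hm := H.hm
  have hmn := H.hmn
  have hX : ∀ w, w ≠ u → n + k ≤ ((nb c j w).erase u).card := by
    intro w hw
    refine (H.P hij hw (by omega)).resolve_left fun h => ?_
    have h1 := card_le_card (inter_subset_left (s₁ := nb c j u) (s₂ := nb c j w))
    have h2 := deg_add (c := c) hij u
    omega
  have hX' : ∀ w, w ≠ u → ((nb c i w).erase u).card + 1 ≤ m := by
    intro w hw
    have := hX w hw
    have := erase_add (c := c) hij hw.symm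
    omega
  obtain ⟨w, hw⟩ : ∃ w, w ≠ u := by
    have : 0 < (nb c i u).card := by omega
    obtain ⟨w, hw⟩ := card_pos.1 this
    exact ⟨w, (mem_nb.1 hw).1⟩
  have hDj : ∀ w, w ≠ u → n + k ≤ (nb c j w).card := fun w hw =>
    (hX w hw).trans (card_le_card (erase_subset _ _))
  have s := dc H.symm i ((nb c i w).erase u) ((univ.erase u).erase w)
  have l : ((univ.erase u).erase w).card • (k - 1) ≤
      ∑ x ∈ (univ.erase u).erase w, ((nb c i w).erase u ∩ nb c i x).card := by
    refine card_nsmul_le_sum _ _ _ fun x hx => ?_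
    simp only [mem_erase, mem_univ, and_true] at hx
    have h1 := H.Q hij (Ne.symm hx.1) (by have := hDj w hw; omega)
      (by have := hDj x hx.2; omega)
    rw [erase_inter]
    have := pred_card_le_card_erase (s := nb c i w ∩ nb c i x) (a := u)
    omega
  have r : ∑ x ∈ (nb c i w).erase u, ((univ.erase u).erase w ∩ nb c i x).card ≤
      ((nb c i w).erase u).card • (m - 2) := by
    refine sum_le_card_nsmul _ _ _ fun x hx => ?_
    have hxu := (mem_erase.1 hx).1
    have hwx := (nb_comm H.symm).1 (mem_erase.1 hx).2
    have hsub : (univ.erase u).erase w ∩ nb c i x ⊆ ((nb c i x).erase u).erase w := by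
      intro y hy
      simp only [mem_inter, mem_erase, mem_univ, and_true] at *
      tauto
    have h1 := card_le_card hsub
    rw [card_erase_of_mem (mem_erase.2 ⟨hw, hwx⟩)] at h1
    have := hX' x hxu
    omega
  rw [card_erase_of_mem (mem_erase.2 ⟨hw, mem_univ _⟩), card_erase_of_mem (mem_univ _), card_univ,
    s, smul_eq_mul] at l
  rw [smul_eq_mul] at r
  have h3 := hX' w hw
  have r2 := l.trans r
  have r3 : ((nb c i w).erase u).card * (m - 2) ≤ (m - 1) * (k - 1) :=
    Nat.mul_le_mul (by omega) (by omega)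
  have r4 := Nat.le_of_mul_le_mul_right (r2.trans r3) (by omega)
  omega

lemma Ctx.case2 (H : Ctx c n m k) {i j : Fin 2} (hij : i ≠ j) {u : V}
    (hd : (nb c i u).card = n + m) (hmax : ∀ l v, (nb c l v).card ≤ n + m) : False := by
  have hc := H.card
  have hk2 := H.k2
  have hmk := H.hmk
  have hm := H.hm
  have hmn := H.hmn
  have h2 := deg_add (c := c) hij u
  have hB : (nb c j u).card = k := by omega
  obtain ⟨b, hb⟩ := card_pos.1 (show 0 < (nb c j u).card by omega)
  have hbu := (mem_nb.1 hb).1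
  have hDb : n + k + 1 ≤ (nb c j b).card := by
    have hub := (nb_comm H.symm).1 hb
    have h3 := card_erase_add_one hub
    rcases H.P hij hbu (by omega) with h | h
    · have h4 := eq_of_subset_of_card_le (inter_subset_left (s₁ := nb c j u) (s₂ := nb c j b))
        (by omega)
      rw [← h4] at hb
      exact (not_self (mem_inter.1 hb).2).elim
    · omega
  have h5 := hmax j b
  have h6 := deg_add (c := c) hij b
  have hR : (nb c i b).card = k := by omega
  obtain ⟨x, hx⟩ := card_pos.1 (show 0 < (nb c i b).card by omega)
  have hxu : x ≠ u := by
    rintro rfl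
    exact nb_not hij hx ((nb_comm H.symm).1 hb)
  rcases H.P hij hxu (by omega) with h | h
  · have h4 := eq_of_subset_of_card_le (inter_subset_left (s₁ := nb c j u) (s₂ := nb c j x))
      (by omega)
    rw [← h4] at hb
    exact nb_not hij hx ((nb_comm H.symm).1 (mem_inter.1 hb).2)
  · have h7 := card_le_card (erase_subset u (nb c j x))
    have h8 := H.Q hij (Ne.symm (mem_nb.1 hx).1) (by omega) (show m + 1 ≤ (nb c j x).card by omega)
    have h4 := eq_of_subset_of_card_le (inter_subset_left (s₁ := nb c i b) (s₂ := nb c i x))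
      (by omega)
    rw [← h4] at hx
    exact not_self (mem_inter.1 hx).2

lemma Ctx.clique (H : Ctx c n m k) {i j : Fin 2} (hij : i ≠ j) {u : V} (hmk : m = k + 1)
    (hd : (nb c i u).card = n + k) (hmax : ∀ l v, (nb c l v).card ≤ n + k) :
    ∀ b ∈ nb c j u, (nb c j u).erase b ⊆ nb c j b := by
  intro b hb
  have hc := H.card
  have hk2 := H.k2
  have h2 := deg_add (c := c) hij u
  have hbu := (mem_nb.1 hb).1
  have hub := (nb_comm H.symm).1 hb
  have h3 := card_erase_add_one hub
  have h5 := hmax j b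
  have h := (H.P hij hbu (by omega)).resolve_right (by omega)
  have h6 := card_erase_add_one hb
  have hsub : nb c j u ∩ nb c j b ⊆ (nb c j u).erase b := by
    intro y hy
    rw [mem_inter] at hy
    exact mem_erase.2 ⟨(mem_nb.1 hy.2).1, hy.1⟩
  rw [← eq_of_subset_of_card_le hsub (by omega)]
  exact inter_subset_right

lemma Ctx.case3 (H : Ctx c n m k) {i j : Fin 2} (hij : i ≠ j) {u w : V} (hmk : m = k + 1)
    (hd : (nb c i u).card = n + k) (hmax : ∀ l v, (nb c l v).card ≤ n + k)
    (hwu : w ≠ u) (hw : n + k ≤ ((nb c j w).erase u).card) : False := by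
  have hc := H.card
  have hk2 := H.k2
  have huw : u ∈ nb c i w := by
    refine (nb_or hij hwu.symm).resolve_right fun h => ?_
    have h3 := card_erase_add_one h
    have h5 := hmax j w
    omega
  have hDw : (nb c j w).card = n + k := by
    have h7 := card_le_card (erase_subset u (nb c j w))
    have h5 := hmax j w
    omega
  have d1 := deg_add (c := c) hij u
  have d2 := deg_add (c := c) hij w
  have cl1 := H.clique hij hmk hd hmax
  have cl2 := H.clique hij.symm hmk hDw hmax
  have e0 := card_erase_add_one huw
  obtain ⟨x, hx⟩ := card_pos.1 (show 0 < ((nb c i w).erase u).card by omega)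
  have hxu := (mem_erase.1 hx).1
  have hxiu : x ∈ nb c i u := cl2 u huw hx
  have hred : ∀ b ∈ nb c j u, b ∈ nb c i x := by
    intro b hb
    have hub := (nb_comm H.symm).1 hb
    have hbw : b ≠ w := by
      rintro rfl
      exact nb_not hij huw hub
    have hxb : x ≠ b := by
      rintro rfl
      exact nb_not hij hxiu hb
    rw [nb_comm H.symm]
    rcases H.P hij.symm hbw (by omega) with h | h
    · have hsub : nb c i w ∩ nb c i b ⊆ (nb c i w).erase u := by
        intro y hy
        rw [mem_inter] at hy
        refine mem_erase.2 ⟨?_, hy.1⟩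
        rintro rfl
        exact nb_not hij hy.2 hub
      rw [← eq_of_subset_of_card_le hsub (by omega)] at hx
      exact (mem_inter.1 hx).2
    · refine (nb_or hij hxb).resolve_right fun hxj => ?_
      have h7 := card_le_card (erase_subset w (nb c i b))
      have d3 := deg_add (c := c) hij b
      have hsub : insert x (insert u ((nb c j u).erase b)) ⊆ nb c j b := by
        intro y hy
        rcases mem_insert.1 hy with rfl | hy
        · exact hxj
        rcases mem_insert.1 hy with rfl | hy
        · exact hub
        exact cl1 b hb hy
      have h8 := card_le_card hsub
      rw [card_insert_of_notMem, card_insert_of_notMem, card_erase_add_one hb] at h8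
      · omega
      · intro h; exact not_self (mem_of_mem_erase h)
      · intro h
        rcases mem_insert.1 h with h | h
        · exact hxu h
        · exact nb_not hij hxiu (mem_of_mem_erase h)
  rcases H.P hij hxu (by omega) with h | h
  · obtain ⟨y, hy⟩ := card_pos.1 (show 0 < (nb c j u ∩ nb c j x).card by omega)
    rw [mem_inter] at hy
    exact nb_not hij (hred y hy.1) hy.2
  · have h7 := card_le_card (erase_subset u (nb c j x))
    have d3 := deg_add (c := c) hij x
    have hsub : insert u (nb c j u) ⊆ nb c i x := by
      intro y hy
      rcases mem_insert.1 hy with rfl | hy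
      · exact (nb_comm H.symm).1 hxiu
      · exact hred y hy
    have h8 := card_le_card hsub
    rw [card_insert_of_notMem not_self] at h8
    omega

lemma dcsum (hs : IsSymm2 c) (j : Fin 2) (u : V) :
    ∑ w ∈ univ.erase u, (nb c j u ∩ nb c j w).card = ∑ b ∈ nb c j u, ((nb c j b).card - 1) := by
  rw [dc hs]
  refine sum_congr rfl fun b hb => ?_
  rw [erase_inter, univ_inter, card_erase_of_mem ((nb_comm hs).1 hb)]

lemma arith {N k d : ℕ} (h1 : N ≤ 4 * k + 3) (hd1 : 2 ≤ d) (hdN : d + 1 ≤ N) (h2 : N ≤ 2 * d + 1)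
    (h : (N - 1) * k ≤ (N - 1 - d) * (d - 1)) : N = 4 * k + 3 ∧ (d = 2 * k + 1 ∨ d = 2 * k + 2) := by
  obtain ⟨x, rfl⟩ : ∃ x, d = x + 1 := ⟨d - 1, by omega⟩
  obtain ⟨y, rfl⟩ : ∃ y, N = y + x + 2 := ⟨N - x - 2, by omega⟩
  have e1 : y + x + 2 - 1 = y + x + 1 := by omega
  have e2 : y + x + 2 - 1 - (x + 1) = y := by omega
  rw [e2, e1, Nat.add_sub_cancel] at h
  have hN : y + x + 2 = 4 * k + 3 := by
    by_contra hne
    have : y + x ≤ 4 * k := by omega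
    have h5 : (y + x + 1) * (y + x) ≤ (y + x + 1) * (4 * k) := Nat.mul_le_mul_left _ this
    have h6 : (1 : ℤ) ≤ x := by omega
    zify at h h5
    nlinarith [sq_nonneg ((y:ℤ) - x)]
  refine ⟨hN, ?_⟩
  have hx : x = 2 * k ∨ x = 2 * k + 1 := by
    by_contra hne
    have hx2 : 2 * k + 2 ≤ x := by omega
    obtain ⟨z, rfl⟩ : ∃ z, x = 2 * k + 2 + z := ⟨x - (2 * k + 2), by omega⟩
    have : (y:ℤ) = 2 * k - 1 - z := by omega
    zify at h
    rw [this] at h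
    nlinarith
  omega

lemma Ctx.caseB (H : Ctx c n m k) {i j : Fin 2} (hij : i ≠ j) {u : V} {d : ℕ}
    (hd : (nb c i u).card = d) (hdn : n + 1 ≤ d) (hmax : ∀ l v, (nb c l v).card ≤ d)
    (hX : ∀ w, w ≠ u → k ≤ (nb c j u ∩ nb c j w).card) : False := by
  have hc := H.card
  have hk2 := H.k2
  have hm0 := H.hm
  have hmn0 := H.hmn
  have hmk := H.hmk
  have hnk := H.nk
  have d1 := deg_add (c := c) hij u
  have hl : (univ.erase u).card • k ≤ ∑ w ∈ univ.erase u, (nb c j u ∩ nb c j w).card :=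
    card_nsmul_le_sum _ _ _ fun w hw => hX w (mem_erase.1 hw).1
  rw [card_erase_of_mem (mem_univ _), card_univ, smul_eq_mul, dcsum H.symm] at hl
  have hBc : (nb c j u).card = Fintype.card V - 1 - d := by omega
  have hr : ∑ b ∈ nb c j u, ((nb c j b).card - 1) ≤ (nb c j u).card • (d - 1) :=
    sum_le_card_nsmul _ _ _ fun b _ => by have := hmax j b; omega
  rw [smul_eq_mul, hBc] at hr
  obtain ⟨hN, hd'⟩ := arith (N := Fintype.card V) (k := k) (d := d) (by omega) (by omega) (by omega)
    (by have := hmax j u; omega) (hl.trans hr)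
  have hn : n = 2 * k + 1 := by omega
  have hm : m = k + 1 := by omega
  have hd2 : d = 2 * k + 2 := by omega
  have hB2 : (nb c j u).card = 2 * k := by omega
  obtain ⟨b, hb, hbd⟩ : ∃ b ∈ nb c j u, (nb c j b).card = d := by
    by_contra! hne
    have hr : ∑ b ∈ nb c j u, ((nb c j b).card - 1) ≤ (nb c j u).card • (2 * k) :=
      sum_le_card_nsmul _ _ _ fun b hb => by have := hmax j b; have := hne b hb; omega
    rw [smul_eq_mul, hB2] at hr
    have := hl.trans hr
    rw [hN] at this
    have e : 4 * k + 3 - 1 = 4 * k + 2 := by omega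
    rw [e] at this
    nlinarith
  have hbu := (mem_nb.1 hb).1
  have d2 := deg_add (c := c) hij b
  have hXb : ∀ w, w ≠ b → k ≤ (nb c i b ∩ nb c i w).card := by
    intro w hw
    refine (H.P hij.symm hw (by omega)).resolve_right fun h => ?_
    have h7 := card_le_card (erase_subset b (nb c i w))
    have := hmax i w
    omega
  have hu : k + 1 ≤ (nb c i b ∩ nb c i u).card := by
    have h1 := hX b hbu
    have h2 := card_union_add_card_inter (nb c j u) (nb c j b)
    have hsub : (univ : Finset V) ⊆ (nb c j u ∪ nb c j b) ∪ (nb c i b ∩ nb c i u) := by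
      intro x _
      have hub := (nb_comm H.symm).1 hb
      simp only [mem_union, mem_inter]
      by_cases hxu : x = u
      · subst hxu; tauto
      by_cases hxb : x = b
      · subst hxb; tauto
      have h1 := nb_or (c := c) hij hxu
      have h2 := nb_or (c := c) hij hxb
      tauto
    have h3 := (card_le_card hsub).trans (card_union_le _ _)
    rw [card_univ] at h3
    omega
  have hlt : (univ.erase b).card • k < ∑ w ∈ univ.erase b, (nb c i b ∩ nb c i w).card := by
    rw [← sum_const]
    exact sum_lt_sum (fun w hw => hXb w (mem_erase.1 hw).1)
      ⟨u, mem_erase.2 ⟨hbu.symm, mem_univ _⟩, by omega⟩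
  rw [card_erase_of_mem (mem_univ _), card_univ, smul_eq_mul, dcsum H.symm] at hlt
  have hr : ∑ x ∈ nb c i b, ((nb c i x).card - 1) ≤ (nb c i b).card • (2 * k + 1) :=
    sum_le_card_nsmul _ _ _ fun x _ => by have := hmax i x; omega
  have hRb : (nb c i b).card = 2 * k := by omega
  rw [smul_eq_mul, hRb] at hr
  have := hlt.trans_le hr
  rw [hN] at this
  have e : 4 * k + 3 - 1 = 4 * k + 2 := by omega
  rw [e] at this
  nlinarith

lemma Ctx.false (H : Ctx c n m k) : False := by
  have hc := H.card
  have hk2 := H.k2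
  have hmk := H.hmk
  have hnk := H.nk
  have hm := H.hm
  have : Nonempty V := Fintype.card_pos_iff.1 (by omega)
  obtain ⟨⟨i, u⟩, hmax⟩ := Finite.exists_max (fun p : Fin 2 × V => (nb c p.1 p.2).card)
  simp only [Prod.forall] at hmax
  obtain ⟨j, hij⟩ : ∃ j : Fin 2, i ≠ j := by
    obtain ⟨j, hj⟩ := exists_ne i
    exact ⟨j, hj.symm⟩
  obtain ⟨d, hd⟩ : ∃ d, (nb c i u).card = d := ⟨_, rfl⟩
  rw [hd] at hmax
  have d1 := deg_add (c := c) hij u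
  have h1 := hmax j u
  rcases Nat.lt_or_ge n d with hdn | hdn
  swap
  · have : d = n := by omega
    subst this
    exact H.caseA hij hd hmax
  by_cases hX : ∀ w, w ≠ u → k ≤ (nb c j u ∩ nb c j w).card
  · exact H.caseB hij hd hdn hmax hX
  push Not at hX
  obtain ⟨w, hwu, hwk⟩ := hX
  have hw := (H.P hij hwu (by omega)).resolve_left (by omega)
  have h2 := hmax j w
  have h7 := card_le_card (erase_subset u (nb c j w))
  rcases Nat.lt_or_ge (n + m) d with h | h
  · exact H.case1 hij (u := u) (by omega)
  by_cases he : d = n + m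
  · subst he
    exact H.case2 hij hd hmax
  have : d = n + k := by omega
  subst this
  exact H.case3 hij (by omega) hd hmax hwu hw

end

/-- Lower bound colorings: two cliques in one color, everything between in the other. -/
lemma lower {N n m a : ℕ} (haN : a ≤ N)
    (hbad : ∀ p q, (p = a ∧ q = N - a) ∨ (p = N - a ∧ q = a) →
      p ≤ n + m + 1 ∧ (n + 1 ≤ p → q ≤ m) ∧ (n + m ≤ p → q ≤ 1)) :
    ∃ c : Fin N → Fin N → Fin 2, IsSymm2 c ∧ ¬ HasMonoTwoStars c n m := by
  let f : Fin N → Bool := fun x => decide (x.1 < a)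
  let A : Bool → Finset (Fin N) := fun s => univ.filter fun x => f x = s
  have hA1 : (A true).card = a := by
    simp only [A, f, decide_eq_true_eq]
    rw [Fin.card_filter_val_lt]; omega
  have hA2 : (A false).card = N - a := by
    have h := card_filter_add_card_filter_not (s := (univ : Finset (Fin N))) (fun x => f x = true)
    simp only [Bool.not_eq_true, card_univ, Fintype.card_fin] at h
    change (A true).card + (A false).card = N at h
    omega
  have hb : ∀ s, (A s).card ≤ n + m + 1 ∧ (n + 1 ≤ (A s).card → (A (!s)).card ≤ m) ∧
      (n + m ≤ (A s).card → (A (!s)).card ≤ 1) := by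
    intro s
    cases s
    · exact hbad _ _ (Or.inr ⟨hA2, hA1⟩)
    · exact hbad _ _ (Or.inl ⟨hA1, hA2⟩)
  have hmem : ∀ s x, x ∈ A s ↔ f x = s := by intro s x; simp [A]
  refine ⟨fun x y => if f x = f y then 0 else 1, fun x y => by simp only [eq_comm], ?_⟩
  rintro ⟨i, u, v, S, T, huv, hS, hT, hST, huS, huT, hvS, hvT, h1, h2⟩
  have hi : i = 0 ∨ i = 1 := by omega
  rcases hi with rfl | rfl
  · have h1' : ∀ x ∈ S, f x = f u := by
      intro x hx; have := h1 x hx; by_contra h; simp [Ne.symm h] at this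
    have h2' : ∀ x ∈ T, f x = f v := by
      intro x hx; have := h2 x hx; by_contra h; simp [Ne.symm h] at this
    by_cases he : f v = f u
    · have hsub : insert u (insert v (S ∪ T)) ⊆ A (f u) := by
        intro x hx
        simp only [mem_insert, mem_union] at hx
        rw [hmem]
        rcases hx with rfl | rfl | hx | hx
        · rfl
        · exact he
        · exact h1' x hx
        · rw [h2' x hx, he]
      have := card_le_card hsub
      rw [card_insert_of_notMem (by simp [huv, huS, huT]),
        card_insert_of_notMem (by simp [hvS, hvT]), card_union_of_disjoint hST] at this
      have := (hb (f u)).1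
      omega
    · have s1 : insert u S ⊆ A (f u) := by
        intro x hx
        rw [hmem]
        rcases mem_insert.1 hx with rfl | hx
        · rfl
        · exact h1' x hx
      have s2 : insert v T ⊆ A (!(f u)) := by
        intro x hx
        have he' : f v = !(f u) := by cases h : f v <;> cases h' : f u <;> simp_all
        rw [hmem, ← he']
        rcases mem_insert.1 hx with rfl | hx
        · rfl
        · exact h2' x hx
      have c1 := card_le_card s1
      have c2 := card_le_card s2
      rw [card_insert_of_notMem huS] at c1
      rw [card_insert_of_notMem hvT] at c2
      have := (hb (f u)).2.1 (by omega)
      omega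
  · have h1' : ∀ x ∈ S, f x = !(f u) := by
      intro x hx; have := h1 x hx
      cases h : f x <;> cases h' : f u <;> simp_all
    have h2' : ∀ x ∈ T, f x = !(f v) := by
      intro x hx; have := h2 x hx
      cases h : f x <;> cases h' : f v <;> simp_all
    by_cases he : f v = f u
    · have s1 : S ∪ T ⊆ A (!(f u)) := by
        intro x hx
        rw [hmem]
        rcases mem_union.1 hx with hx | hx
        · exact h1' x hx
        · rw [h2' x hx, he]
      have s2 : {u, v} ⊆ A (!!(f u)) := by
        intro x hx
        rw [hmem, Bool.not_not]
        rcases mem_insert.1 hx with rfl | hx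
        · rfl
        · rw [mem_singleton.1 hx, he]
      have c1 := card_le_card s1
      have c2 := card_le_card s2
      rw [card_union_of_disjoint hST] at c1
      rw [card_pair huv] at c2
      have := (hb (!(f u))).2.2 (by omega)
      omega
    · have he' : f v = !(f u) := by cases h : f v <;> cases h' : f u <;> simp_all
      have s1 : insert v S ⊆ A (!(f u)) := by
        intro x hx
        rw [hmem]
        rcases mem_insert.1 hx with rfl | hx
        · exact he'
        · exact h1' x hx
      have s2 : insert u T ⊆ A (!!(f u)) := by
        intro x hx
        rw [hmem]
        rcases mem_insert.1 hx with rfl | hx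
        · simp
        · rw [h2' x hx, he']
      have c1 := card_le_card s1
      have c2 := card_le_card s2
      rw [card_insert_of_notMem hvS] at c1
      rw [card_insert_of_notMem huT] at c2
      have := (hb (!(f u))).2.1 (by omega)
      omega

end UStars

/-- Grossman's theorem: `R(K_{1,n} ∪ K_{1,m}) = max {n+2m, 2n+1, n+m+3}` for `n ≥ m ≥ 1`. -/
theorem ramsey_union_stars (n m : ℕ) (hm : 1 ≤ m) (hmn : m ≤ n) :
    (∀ c : Fin (max (n + 2 * m) (max (2 * n + 1) (n + m + 3))) →
        Fin (max (n + 2 * m) (max (2 * n + 1) (n + m + 3))) → Fin 2,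
      IsSymm2 c → HasMonoTwoStars c n m) ∧
    (∃ c : Fin (max (n + 2 * m) (max (2 * n + 1) (n + m + 3)) - 1) →
        Fin (max (n + 2 * m) (max (2 * n + 1) (n + m + 3)) - 1) → Fin 2,
      IsSymm2 c ∧ ¬ HasMonoTwoStars c n m) := by
  obtain ⟨N, hN⟩ : ∃ N, max (n + 2 * m) (max (2 * n + 1) (n + m + 3)) = N := ⟨_, rfl⟩
  rw [hN]
  constructor
  · intro c hc
    by_contra hno
    exact UStars.Ctx.false (c := c) (n := n) (m := m) (k := N - n - m - 1)
      ⟨hc, hno, by rw [Fintype.card_fin]; omega, hm, hmn, by omega, by omega, by omega⟩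
  · have h3 : N = n + 2 * m ∨ N = 2 * n + 1 ∨ N = n + m + 3 := by omega
    rcases h3 with h | h | h
    · exact UStars.lower (a := m) (by omega) (by intro p q h; omega)
    · exact UStars.lower (a := n) (by omega) (by intro p q h; omega)
    · exact UStars.lower (a := 1) (by omega) (by intro p q h; omega)
end

section
/- Let n ≥ 22, m ≥ 5, and k ≥ 3 be integers with m ≤ (n−8)/6. Then the Gallai-Ramsey number gr_k(K_3 : K_{1,n} ∪ K_{1,m}) equals (5n−6)/2 + k − 3 if n is even, and (5n−3)/2 + k − 3 if n is odd. -/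
open Finset

section Helpers
open Classical

/-- Neighbours of `v` inside `S` in colour `i`. -/
noncomputable def nb {V C : Type*} (c : V → V → C) (S : Finset V) (i : C) (v : V) : Finset V :=
  S.filter (fun y => y ≠ v ∧ c v y = i)

/-- No rainbow triangle, positive form. -/
def NoRb {V C : Type*} (c : V → V → C) : Prop :=
  ∀ a b d : V, a ≠ b → a ≠ d → b ≠ d → c a b = c a d ∨ c a b = c b d ∨ c a d = c b d

lemma mem_nb {V C : Type*} {c : V → V → C} {S : Finset V} {i : C} {v y : V} :
    y ∈ nb c S i v ↔ y ∈ S ∧ y ≠ v ∧ c v y = i := by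
  simp [nb]

lemma two_stars {V C : Type*} {c : V → V → C} {n m : ℕ} {i : C} {u v : V} (huv : u ≠ v)
    (X Y : Finset V) (hX : ∀ x ∈ X, x ≠ u ∧ x ≠ v ∧ c u x = i)
    (hY : ∀ x ∈ Y, x ≠ u ∧ x ≠ v ∧ c v x = i)
    (h1 : n ≤ X.card) (h2 : m ≤ Y.card) (h3 : n + m ≤ (X ∪ Y).card) :
    HasMonoTwoStars c n m := by
  obtain ⟨S, T, hS, hT, hSX, hTY, hd⟩ : ∃ S T : Finset V, S.card = n ∧ T.card = m ∧
      S ⊆ X ∧ T ⊆ Y ∧ Disjoint S T := by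
    have hc : (X ∪ Y).card = X.card + (Y \ X).card := by
      rw [← Finset.card_union_of_disjoint Finset.disjoint_sdiff]
      congr 1; ext; simp
    by_cases h : m ≤ (Y \ X).card
    · obtain ⟨T, hT, hTc⟩ := Finset.exists_subset_card_eq h
      obtain ⟨S, hS, hSc⟩ := Finset.exists_subset_card_eq h1
      refine ⟨S, T, hSc, hTc, hS, hT.trans Finset.sdiff_subset, ?_⟩
      exact Finset.disjoint_of_subset_left hS
        (Finset.disjoint_of_subset_right hT Finset.disjoint_sdiff)
    · push Not at h
      obtain ⟨T, hT1, hT2, hTc⟩ := Finset.exists_subsuperset_card_eq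
        (Finset.sdiff_subset : Y \ X ⊆ Y) h.le h2
      have hXT : (X \ T).card + m = (X ∪ Y).card := by
        rw [← hTc, ← Finset.card_union_of_disjoint Finset.sdiff_disjoint]
        congr 1
        ext x
        have a1 := @hT1 x
        have a2 := @hT2 x
        simp at a1 a2 ⊢
        tauto
      obtain ⟨S, hS, hSc⟩ := Finset.exists_subset_card_eq (show n ≤ (X \ T).card by omega)
      exact ⟨S, T, hSc, hTc, hS.trans Finset.sdiff_subset, hT2,
        Finset.disjoint_of_subset_left hS Finset.sdiff_disjoint⟩
  refine ⟨i, u, v, S, T, huv, hS, hT, hd, ?_, ?_, ?_, ?_, ?_, ?_⟩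
  · intro h; exact (hX _ (hSX h)).1 rfl
  · intro h; exact (hY _ (hTY h)).1 rfl
  · intro h; exact (hX _ (hSX h)).2.1 rfl
  · intro h; exact (hY _ (hTY h)).2.1 rfl
  · intro x h; exact (hX _ (hSX h)).2.2
  · intro x h; exact (hY _ (hTY h)).2.2

/-- Edges inside `S` avoiding colours `i`, `j`. -/
def HH {V C : Type*} (c : V → V → C) (S : Finset V) (i j : C) (x y : V) : Prop :=
  x ∈ S ∧ y ∈ S ∧ c x y ≠ i ∧ c x y ≠ j

/-- Reachability along edges avoiding `i`, `j`. -/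
def RR {V C : Type*} (c : V → V → C) (S : Finset V) (i j : C) : V → V → Prop :=
  Relation.ReflTransGen (HH c S i j)

lemma RR_symm {V C : Type*} {c : V → V → C} (hs : IsSymm2 c) {S : Finset V} {i j : C} {x y : V}
    (h : RR c S i j x y) : RR c S i j y x := by
  have key : ∀ a b, HH c S i j a b → HH c S i j b a := by
    intro a b ⟨h1, h2, h3, h4⟩
    exact ⟨h2, h1, by rwa [hs], by rwa [hs]⟩
  induction h with
  | refl => exact Relation.ReflTransGen.refl
  | tail _ hbb ih => exact Relation.ReflTransGen.head (key _ _ hbb) ih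

lemma RR_cross {V C : Type*} {c : V → V → C} {S : Finset V} {i j : C} {x y : V}
    (hx : x ∈ S) (hy : y ∈ S) (h : ¬ RR c S i j x y) : c x y = i ∨ c x y = j := by
  by_contra h'
  push Not at h'
  exact h (Relation.ReflTransGen.single ⟨hx, hy, h'.1, h'.2⟩)

lemma RR_homog {V C : Type*} {c : V → V → C} (hs : IsSymm2 c) (hr : NoRb c)
    {S : Finset V} {i j : C} {x x' z : V}
    (hz : z ∈ S) (h : RR c S i j x x') (hn : ¬ RR c S i j x z) : c x z = c x' z := by
  induction h with
  | refl => rfl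
  | @tail b b' hb hbb ih =>
    rw [ih]
    have nb1 : ¬ RR c S i j b z := fun h => hn (hb.trans h)
    have nb2 : ¬ RR c S i j b' z := fun h => hn ((hb.tail hbb).trans h)
    have c1 := RR_cross hbb.1 hz nb1
    have c2 := RR_cross hbb.2.1 hz nb2
    by_cases e : b = b'
    · rw [e]
    have e1 : b ≠ z := by rintro rfl; exact nb1 Relation.ReflTransGen.refl
    have e2 : b' ≠ z := by rintro rfl; exact nb2 Relation.ReflTransGen.refl
    obtain ⟨-, -, g1, g2⟩ := hbb
    rcases hr b b' z e e1 e2 with h | h | h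
    · rw [h] at g1 g2; tauto
    · rw [h] at g1 g2; tauto
    · exact h

lemma cut_exists {V C : Type*} {c : V → V → C} (hs : IsSymm2 c) (hr : NoRb c)
    (S : Finset V) (hS : 2 ≤ S.card) :
    ∃ i j : C, ∃ P ⊆ S, P.Nonempty ∧ (S \ P).Nonempty ∧
      ∀ x ∈ P, ∀ y ∈ S \ P, c x y = i ∨ c x y = j := by
  induction S using Finset.induction_on with
  | empty => simp at hS
  | @insert v S' hv ih =>
    rw [Finset.card_insert_of_notMem hv] at hS
    have hne : S'.Nonempty := Finset.card_pos.mp (by omega)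
    have hsd : insert v S' \ {v} = S' := by
      ext x; simp only [Finset.mem_sdiff, Finset.mem_insert, Finset.mem_singleton]
      constructor
      · tauto
      · intro h; exact ⟨Or.inr h, by rintro rfl; exact hv h⟩
    by_cases hall : ∃ l, ∀ y ∈ S', c v y = l
    · obtain ⟨l, hl⟩ := hall
      refine ⟨l, l, {v}, by simp, by simp, by rwa [hsd], ?_⟩
      rw [hsd]
      intro x hx y hy
      simp at hx; subst hx
      exact Or.inl (hl y hy)
    push Not at hall
    have h2 : 2 ≤ S'.card := by
      by_contra h
      obtain ⟨y, hy⟩ := Finset.card_eq_one.mp (show S'.card = 1 by omega)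
      subst hy
      obtain ⟨z, hz, hz'⟩ := hall (c v y)
      simp at hz; subst hz; exact hz' rfl
    obtain ⟨i, j, P, hPS, hP, hQ, hPQ⟩ := ih h2
    have hcl : ∀ x y, x ∈ P → y ∈ S' \ P → ¬ RR c S' i j x y := by
      intro x y hx hy h
      have : y ∈ P := by
        clear hy
        induction h with
        | refl => exact hx
        | @tail b b' _ hbb ih =>
          by_contra hb'
          have := hPQ b ih b' (by simp [hb', hbb.2.1])
          obtain ⟨-, -, g1, g2⟩ := hbb
          tauto
      simp at hy; exact hy.2 this
    have hfar : ∀ x ∈ S', ∃ z ∈ S', ¬ RR c S' i j x z := by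
      intro x hx
      by_cases hxP : x ∈ P
      · obtain ⟨z, hz⟩ := hQ
        exact ⟨z, (Finset.mem_sdiff.mp hz).1, hcl x z hxP hz⟩
      · obtain ⟨z, hz⟩ := hP
        exact ⟨z, hPS hz, fun h => hcl z x hz (by simp [hx, hxP]) (RR_symm hs h)⟩
    have hvne : ∀ x ∈ S', v ≠ x := by rintro x hx rfl; exact hv hx
    have compS : ∀ e l : C, ∀ z ∈ S', (∀ x ∈ S', RR c S' i j z x → c v x = e ∨ c v x = l) →
        (∀ x ∈ S', ∀ y ∈ S', RR c S' i j z x → ¬ RR c S' i j z y → c x y = e ∨ c x y = l) →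
        ∃ i j : C, ∃ P ⊆ insert v S', P.Nonempty ∧ (insert v S' \ P).Nonempty ∧
          ∀ x ∈ P, ∀ y ∈ insert v S' \ P, c x y = i ∨ c x y = j := by
      intro e l z hz h1 h2
      refine ⟨e, l, S'.filter (fun x => RR c S' i j z x), ?_, ?_, ?_, ?_⟩
      · exact (Finset.filter_subset _ _).trans (Finset.subset_insert _ _)
      · exact ⟨z, by simp [hz]; exact Relation.ReflTransGen.refl⟩
      · exact ⟨v, by simp [hv]⟩
      · intro x hx y hy
        simp at hx hy
        rcases hy with ⟨rfl | hy, hy'⟩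
        · rw [hs]; exact h1 x hx.1 hx.2
        · exact h2 x hx.1 y hy hx.2 (hy' hy)
    by_cases hA : ∃ z ∈ S', ∀ x ∈ S', RR c S' i j z x → c v x = i ∨ c v x = j
    · obtain ⟨z, hz, hzz⟩ := hA
      refine compS i j z hz hzz ?_
      intro x hx y hy h1 h2
      exact RR_cross hx hy (fun h => h2 (h1.trans h))
    push Not at hA
    have eq1 : ∀ x ∈ S', ∀ y ∈ S', ¬ RR c S' i j x y → (c v x ≠ i ∧ c v x ≠ j) →
        (c v y ≠ i ∧ c v y ≠ j) → c v x = c v y := by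
      intro x hx y hy hxy h1 h2
      have hxy' : x ≠ y := by rintro rfl; exact hxy Relation.ReflTransGen.refl
      have := RR_cross hx hy hxy
      rcases hr v x y (hvne x hx) (hvne y hy) hxy' with h | h | h
      · exact h
      · rw [h] at h1; tauto
      · rw [h] at h2; tauto
    have eq2 : ∀ x ∈ S', ∀ y ∈ S', (c v x ≠ i ∧ c v x ≠ j) →
        (c v y ≠ i ∧ c v y ≠ j) → c v x = c v y := by
      intro x hx y hy h1 h2
      by_cases hxy : RR c S' i j x y
      · obtain ⟨z, hz, hxz⟩ := hfar x hx
        obtain ⟨z', hz', hzz, hc⟩ := hA z hz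
        have n1 : ¬ RR c S' i j x z' := fun h => hxz (h.trans (RR_symm hs hzz))
        have n2 : ¬ RR c S' i j y z' := fun h => n1 (hxy.trans h)
        rw [eq1 x hx z' hz' n1 h1 hc, eq1 y hy z' hz' n2 h2 hc]
      · exact eq1 x hx y hy hxy h1 h2
    obtain ⟨w, hw⟩ := hne
    obtain ⟨x0, hx0, -, hl⟩ := hA w hw
    obtain ⟨y, hy, hyl⟩ := hall (c v x0)
    have hwit : ∀ z ∈ S', ∃ z' ∈ S', RR c S' i j z z' ∧ c v z' = c v x0 := by
      intro z hz
      obtain ⟨z', hz', hzz, hc⟩ := hA z hz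
      exact ⟨z', hz', hzz, eq2 z' hz' x0 hx0 hc hl⟩
    have key : ∀ y' ∈ S', ∀ z ∈ S', RR c S' i j y y' → ¬ RR c S' i j y z → c y' z = c v y := by
      intro y' hy' z hz h1 h2
      obtain ⟨z', hz', hzz, hc⟩ := hwit z hz
      have n1 : ¬ RR c S' i j y z' := fun h => h2 (h.trans (RR_symm hs hzz))
      have n2 : ¬ RR c S' i j z' y' := fun h => n1 (h1.trans (RR_symm hs h))
      have hyz : y ≠ z' := by rintro rfl; exact n1 Relation.ReflTransGen.refl
      have e1 := RR_homog hs hr hz' h1 n1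
      have e2 := RR_homog hs hr hy' (RR_symm hs hzz) n2
      have e3 := RR_cross hy hz' n1
      have e4 : c y z' = c v y := by
        rcases hr v y z' (hvne y hy) (hvne z' hz') hyz with h | h | h
        · rw [hc] at h; exact absurd h hyl
        · exact h.symm
        · rw [hc] at h; rw [← h] at e3; tauto
      rw [← e4, e1, hs y' z', e2, hs]
    refine compS (c v y) (c v x0) y hy ?_ ?_
    · intro y' hy' h1
      obtain ⟨z, hz, hyz⟩ := hfar y hy
      obtain ⟨z', hz', hzz, hc⟩ := hwit z hz
      have n1 : ¬ RR c S' i j y z' := fun h => hyz (h.trans (RR_symm hs hzz))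
      have k := key y' hy' z' hz' h1 n1
      have hne : y' ≠ z' := by rintro rfl; exact n1 h1
      rcases hr v y' z' (hvne y' hy') (hvne z' hz') hne with h | h | h
      · right; rw [h, hc]
      · left; rw [h, k]
      · exfalso; apply hyl; rw [← k, ← h, hc]
    · intro x hx z hz h1 h2
      exact Or.inl (key x hx z hz h1 h2)

lemma gallai_partition {V C : Type*} [Nontrivial C] {c : V → V → C} (hs : IsSymm2 c) (hr : NoRb c)
    (S : Finset V) (hS : 2 ≤ S.card) :
    ∃ i j : C, i ≠ j ∧ ∃ E : V → V → Prop, Equivalence E ∧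
      (∀ x ∈ S, ∀ y ∈ S, ¬ E x y → c x y = i ∨ c x y = j) ∧
      (∀ x x' : V, ∀ z ∈ S, E x x' → ¬ E x z → c x z = c x' z) ∧
      (∃ x ∈ S, ∃ y ∈ S, ¬ E x y) := by
  obtain ⟨i, j, P, hPS, hP, hQ, hPQ⟩ := cut_exists hs hr S hS
  obtain ⟨j', hj', hj2⟩ : ∃ j', i ≠ j' ∧ ∀ x, (x = i ∨ x = j) → (x = i ∨ x = j') := by
    by_cases h : i = j
    · obtain ⟨j', h'⟩ := exists_ne i
      exact ⟨j', h'.symm, by subst h; tauto⟩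
    · exact ⟨j, h, fun x h => h⟩
  refine ⟨i, j', hj', RR c S i j', ⟨fun _ => Relation.ReflTransGen.refl, RR_symm hs,
    fun h1 h2 => h1.trans h2⟩, fun x hx y hy h => RR_cross hx hy h,
    fun x x' z hz h1 h2 => RR_homog hs hr hz h1 h2, ?_⟩
  obtain ⟨x, hx⟩ := hP
  obtain ⟨y, hy⟩ := hQ
  refine ⟨x, hPS hx, y, (Finset.mem_sdiff.mp hy).1, ?_⟩
  intro h
  have : y ∈ P := by
    clear hy
    induction h with
    | refl => exact hx
    | @tail b b' _ hbb ih =>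
      by_contra hb'
      have := hj2 _ (hPQ b ih b' (by simp [hb', hbb.2.1]))
      obtain ⟨-, -, g1, g2⟩ := hbb
      tauto
  simp at hy; exact hy.2 this

/-- A homogeneous set `A` with its two colour neighbourhoods. -/
structure Tri {V C : Type*} (c : V → V → C) (S A R B : Finset V) (i j : C) : Prop where
  AS : A ⊆ S
  RS : R ⊆ S
  BS : B ⊆ S
  cov : ∀ x ∈ S, x ∈ A ∨ x ∈ R ∨ x ∈ B
  dAR : Disjoint A R
  dAB : Disjoint A B
  dRB : Disjoint R B
  hAR : ∀ x ∈ A, ∀ y ∈ R, c x y = i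
  hAB : ∀ x ∈ A, ∀ y ∈ B, c x y = j
  hRB : ∀ x ∈ R, ∀ y ∈ B, c x y = i ∨ c x y = j
  ij : i ≠ j

namespace Tri

variable {V C : Type*} {c : V → V → C} {S A R B : Finset V} {i j : C}

lemma swap (hs : IsSymm2 c) (t : Tri c S A R B i j) : Tri c S A B R j i where
  AS := t.AS
  RS := t.BS
  BS := t.RS
  cov := fun x hx => by have := t.cov x hx; tauto
  dAR := t.dAB
  dAB := t.dAR
  dRB := t.dRB.symm
  hAR := t.hAB
  hAB := t.hAR
  hRB := fun x hx y hy => by rw [hs]; exact (t.hRB y hy x hx).symm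
  ij := t.ij.symm

lemma card (t : Tri c S A R B i j) : S.card = A.card + R.card + B.card := by
  have : S = (A ∪ R) ∪ B := by
    ext x
    have h1 := t.cov x
    have h2 := @t.AS x
    have h3 := @t.RS x
    have h4 := @t.BS x
    simp only [Finset.mem_union]; tauto
  rw [this, Finset.card_union_of_disjoint, Finset.card_union_of_disjoint t.dAR]
  rw [Finset.disjoint_union_left]; exact ⟨t.dAB, t.dRB⟩

lemma R_sub (t : Tri c S A R B i j) {v : V} (hv : v ∈ A) : R ⊆ nb c S i v := by
  intro x hx
  refine mem_nb.mpr ⟨t.RS hx, ?_, t.hAR v hv x hx⟩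
  rintro rfl
  exact Finset.disjoint_left.mp t.dAR hv hx

lemma A_sub (hs : IsSymm2 c) (t : Tri c S A R B i j) {v : V} (hv : v ∈ R) : A ⊆ nb c S i v := by
  intro x hx
  refine mem_nb.mpr ⟨t.AS hx, ?_, by rw [hs]; exact t.hAR x hx v hv⟩
  rintro rfl
  exact Finset.disjoint_left.mp t.dAR hx hv

lemma count_half (hs : IsSymm2 c) (t : Tri c S A R B i j) {D : ℕ}
    (hD : ∀ v ∈ S, (nb c S i v).card ≤ D) :
    ((R ×ˢ B).filter (fun q => c q.1 q.2 = i)).card + R.card * A.card ≤ R.card * D := by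
  have h1 : ((R ×ˢ B).filter (fun q => c q.1 q.2 = i)).card
      = ∑ w ∈ R, (B.filter (fun z => c w z = i)).card := by
    rw [Finset.card_filter, Finset.sum_product]
    apply Finset.sum_congr rfl
    intro w _
    rw [Finset.card_filter]
  rw [h1]
  have h2 : ∀ w ∈ R, (B.filter (fun z => c w z = i)).card + A.card ≤ D := by
    intro w hw
    refine le_trans ?_ (hD w (t.RS hw))
    rw [← Finset.card_union_of_disjoint]
    · apply Finset.card_le_card
      apply Finset.union_subset _ (t.A_sub hs hw)
      intro x hx
      simp only [Finset.mem_filter] at hx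
      refine mem_nb.mpr ⟨t.BS hx.1, ?_, hx.2⟩
      rintro rfl
      exact Finset.disjoint_left.mp t.dRB hw hx.1
    · exact (Finset.disjoint_of_subset_right (Finset.filter_subset _ _) t.dAB).symm
  calc _ = ∑ w ∈ R, ((B.filter (fun z => c w z = i)).card + A.card) := by
        rw [Finset.sum_add_distrib]; simp
    _ ≤ ∑ w ∈ R, D := Finset.sum_le_sum h2
    _ = _ := by simp

lemma count (hs : IsSymm2 c) (t : Tri c S A R B i j) {D : ℕ}
    (hi : ∀ v ∈ S, (nb c S i v).card ≤ D) (hj : ∀ v ∈ S, (nb c S j v).card ≤ D) :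
    R.card * B.card + (R.card + B.card) * A.card ≤ (R.card + B.card) * D := by
  have h1 := t.count_half hs hi
  have h2 := (t.swap hs).count_half hs hj
  have h3 : R.card * B.card ≤ ((R ×ˢ B).filter (fun q => c q.1 q.2 = i)).card +
      ((B ×ˢ R).filter (fun q => c q.1 q.2 = j)).card := by
    have : ((B ×ˢ R).filter (fun q => c q.1 q.2 = j)).card
        = ((R ×ˢ B).filter (fun q => c q.1 q.2 = j)).card := by
      apply Finset.card_bij (fun q _ => (q.2, q.1))
      · intro q hq
        simp only [Finset.mem_filter, Finset.mem_product] at hq ⊢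
        rw [hs]; tauto
      · rintro ⟨a, b⟩ _ ⟨a', b'⟩ _ h
        simp at h ⊢; tauto
      · rintro ⟨a, b⟩ hq
        refine ⟨(b, a), ?_, rfl⟩
        simp only [Finset.mem_filter, Finset.mem_product] at hq ⊢
        rw [hs]; tauto
    rw [this, ← Finset.card_product]
    refine le_trans (Finset.card_le_card ?_) (Finset.card_union_le _ _)
    rintro ⟨x, y⟩ hxy
    simp only [Finset.mem_union, Finset.mem_filter, Finset.mem_product] at hxy ⊢
    have := t.hRB x hxy.1 y hxy.2
    tauto
  nlinarith

lemma bounds (hs : IsSymm2 c) (t : Tri c S A R B i j) {D : ℕ}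
    (hi : ∀ v ∈ S, (nb c S i v).card ≤ D) (hj : ∀ v ∈ S, (nb c S j v).card ≤ D)
    (hA : A.Nonempty) (hRB : 1 ≤ R.card + B.card) :
    A.card ≤ D ∧ R.card ≤ D ∧ B.card ≤ D ∧ A.card * (R.card + B.card) ≤ D * D ∧
      2 * A.card + R.card + B.card ≤ 3 * D := by
  obtain ⟨v, hv⟩ := hA
  have r1 : R.card ≤ D := (Finset.card_le_card (t.R_sub hv)).trans (hi v (t.AS hv))
  have b1 : B.card ≤ D := (Finset.card_le_card ((t.swap hs).R_sub hv)).trans (hj v (t.AS hv))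
  have a1 : A.card ≤ D := by
    rcases R.eq_empty_or_nonempty with h | ⟨w, hw⟩
    · subst h
      obtain ⟨w, hw⟩ := Finset.card_pos.mp (show 0 < B.card by simpa using hRB)
      exact (Finset.card_le_card ((t.swap hs).A_sub hs hw)).trans (hj w (t.BS hw))
    · exact (Finset.card_le_card (t.A_sub hs hw)).trans (hi w (t.RS hw))
  have hc := t.count hs hi hj
  have hA0 : 0 < A.card := Finset.card_pos.mpr ⟨v, hv⟩
  generalize A.card = a at *
  generalize R.card = r at *
  generalize B.card = b at *
  have h4 : a * (r + b) ≤ D * D := by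
    zify at *
    nlinarith [mul_nonneg (sub_nonneg.mpr r1) (sub_nonneg.mpr b1)]
  refine ⟨a1, r1, b1, h4, ?_⟩
  have hD : 0 < D := by omega
  zify at *
  have h5 := mul_nonneg (sub_nonneg.mpr a1) (show (0 : ℤ) ≤ 2 * D - (r + b) by linarith)
  by_contra h
  push Not at h
  have : (D : ℤ) * (2 * a + r + b - 3 * D) > 0 := mul_pos hD (by linarith)
  nlinarith

end Tri

lemma tri_of_part {V C : Type*} {c : V → V → C} (hs : IsSymm2 c) {S : Finset V} {i j : C}
    (hij : i ≠ j) {E : V → V → Prop} (hE : Equivalence E)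
    (h1 : ∀ x ∈ S, ∀ y ∈ S, ¬ E x y → c x y = i ∨ c x y = j)
    (h2 : ∀ x x' : V, ∀ z ∈ S, E x x' → ¬ E x z → c x z = c x' z) {w : V} (hw : w ∈ S) :
    Tri c S (S.filter (fun y => E w y)) (S.filter (fun y => ¬ E w y ∧ c w y = i))
      (S.filter (fun y => ¬ E w y ∧ c w y = j)) i j where
  AS := Finset.filter_subset _ _
  RS := Finset.filter_subset _ _
  BS := Finset.filter_subset _ _
  cov := by
    intro x hx
    have := h1 w hw x hx
    simp only [Finset.mem_filter]; tauto
  dAR := by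
    rw [Finset.disjoint_left]; intro x; simp only [Finset.mem_filter]; tauto
  dAB := by
    rw [Finset.disjoint_left]; intro x; simp only [Finset.mem_filter]; tauto
  dRB := by
    rw [Finset.disjoint_left]; intro x hx hx'
    simp only [Finset.mem_filter] at hx hx'
    exact hij (hx.2.2.symm.trans hx'.2.2)
  hAR := by
    intro x hx y hy
    simp only [Finset.mem_filter] at hx hy
    rw [← h2 w x y hy.1 hx.2 hy.2.1, hy.2.2]
  hAB := by
    intro x hx y hy
    simp only [Finset.mem_filter] at hx hy
    rw [← h2 w x y hy.1 hx.2 hy.2.1, hy.2.2]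
  hRB := by
    intro x hx y hy
    simp only [Finset.mem_filter] at hx hy
    apply h1 x hx.1 y hy.1
    intro hxy
    have := h2 x y w hw hxy (fun h => hx.2.1 (hE.symm h))
    rw [hs x w, hs y w, hx.2.2, hy.2.2] at this
    exact hij this
  ij := hij

lemma part_RB {V C : Type*} {c : V → V → C} {S A R B : Finset V} {i j : C}
    (t : Tri c S A R B i j) {E : V → V → Prop} (hE : Equivalence E) {w : V}
    (hA : A = S.filter (fun y => E w y))
    (h3 : ∃ x ∈ S, ∃ y ∈ S, ¬ E x y) : 1 ≤ R.card + B.card := by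
  obtain ⟨x, hx, y, hy, hxy⟩ := h3
  have : ∃ z ∈ S, z ∉ A := by
    by_contra h
    push Not at h
    have a1 := h x hx
    have a2 := h y hy
    simp only [hA, Finset.mem_filter] at a1 a2
    exact hxy (hE.trans (hE.symm a1.2) a2.2)
  obtain ⟨z, hz, hz'⟩ := this
  rcases t.cov z hz with h | h | h
  · exact absurd h hz'
  · have := Finset.card_pos.mpr ⟨z, h⟩; omega
  · have := Finset.card_pos.mpr ⟨z, h⟩; omega

/-- Gyárfás–Simonyi: some monochromatic degree is at least `2|S|/5`. -/
lemma star_bound {V C : Type*} [Nontrivial C] {c : V → V → C} (hs : IsSymm2 c) (hr : NoRb c)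
    (S : Finset V) (hS : 2 ≤ S.card) (D : ℕ) (hD : ∀ i, ∀ v ∈ S, (nb c S i v).card ≤ D) :
    2 * S.card ≤ 5 * D := by
  obtain ⟨i, j, hij, E, hE, h1, h2, h3⟩ := gallai_partition hs hr S hS
  obtain ⟨w, hw, -⟩ := id h3
  have t := tri_of_part hs hij hE h1 h2 hw
  have hRB := part_RB t hE rfl h3
  have hb := t.bounds hs (hD i) (hD j) ⟨w, by simp [hw, hE.refl]⟩ hRB
  have := t.card
  omega

/-- In the main configuration red degrees are at most `n`. -/
lemma deg_le {V C : Type*} {c : V → V → C} (hs : IsSymm2 c) {n m : ℕ}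
    (hts : ¬ HasMonoTwoStars c n m) (hm : 5 ≤ m) (hmn : 6 * m + 8 ≤ n)
    {S A R B : Finset V} {i j : C} (t : Tri c S A R B i j)
    (hF : 5 * n ≤ 2 * S.card + 8) (ha : A.card ≤ n) (hr : R.card ≤ n) (hb : B.card ≤ n)
    {u : V} (hu : u ∈ S) : (nb c S i u).card ≤ n := by
  by_contra hdeg
  push Not at hdeg
  have hcard := t.card
  have gen : ∀ v ∈ S, v ≠ u → m + 1 ≤ (nb c S i v).card →
      ((nb c S i u ∪ nb c S i v) \ {u, v}).card < n + m := by
    intro v hv hvu hd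
    by_contra hlt
    push Not at hlt
    apply hts
    refine two_stars (i := i) hvu.symm ((nb c S i u).erase v) ((nb c S i v).erase u) ?_ ?_ ?_ ?_ ?_
    · intro x hx
      rw [Finset.mem_erase, mem_nb] at hx; tauto
    · intro x hx
      rw [Finset.mem_erase, mem_nb] at hx; tauto
    · have := Finset.pred_card_le_card_erase (s := nb c S i u) (a := v); omega
    · have := Finset.pred_card_le_card_erase (s := nb c S i v) (a := u); omega
    · refine hlt.trans (Finset.card_le_card ?_)
      intro x
      simp only [Finset.mem_sdiff, Finset.mem_union, Finset.mem_erase, Finset.mem_insert,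
        Finset.mem_singleton]
      tauto
  have big : ∀ v ∈ S, v ≠ u → m + 1 ≤ (nb c S i v).card → (nb c S i u).card ≤ n + m := by
    intro v hv hvu hd
    have h1 := gen v hv hvu hd
    have h2 : ((nb c S i u).erase v).card ≤ ((nb c S i u ∪ nb c S i v) \ {u, v}).card := by
      apply Finset.card_le_card
      intro x hx
      rw [Finset.mem_erase, mem_nb] at hx
      simp only [Finset.mem_sdiff, Finset.mem_union, Finset.mem_insert, Finset.mem_singleton, mem_nb]
      tauto
    have := Finset.pred_card_le_card_erase (s := nb c S i u) (a := v)
    omega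
  -- if X avoids v, X ⊆ N(v), then X \ N(u) small
  have small : ∀ v ∈ S, v ≠ u → ∀ X ⊆ nb c S i v, m + 1 ≤ X.card →
      (X \ nb c S i u).card ≤ m := by
    intro v hv hvu X hX hXc
    have h1 := gen v hv hvu (hXc.trans (Finset.card_le_card hX))
    have h2 : (((X \ nb c S i u) ∪ nb c S i u)).card ≤
        ((nb c S i u ∪ nb c S i v) \ {u, v}).card + ({u, v} : Finset V).card := by
      refine le_trans (Finset.card_le_card ?_) (Finset.card_union_le _ _)
      intro x hx
      have := @hX x
      simp only [Finset.mem_sdiff, Finset.mem_union, Finset.mem_insert, Finset.mem_singleton]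
        at hx ⊢
      tauto
    rw [Finset.card_union_of_disjoint Finset.sdiff_disjoint] at h2
    have : ({u, v} : Finset V).card ≤ 2 := Finset.card_le_two
    omega
  obtain ⟨v, hv, hvu⟩ := Finset.exists_mem_ne (show 1 < A.card by omega) u
  obtain ⟨w, hw, hwu⟩ := Finset.exists_mem_ne (show 1 < R.card by omega) u
  have sR := small v (t.AS hv) hvu R (t.R_sub hv) (by omega)
  have sA := small w (t.RS hw) hwu A (t.A_sub hs hw) (by omega)
  have hbig := big v (t.AS hv) hvu
    ((show m + 1 ≤ R.card by omega).trans (Finset.card_le_card (t.R_sub hv)))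
  have tot : A.card + R.card ≤ (A \ nb c S i u).card + (R \ nb c S i u).card
      + (nb c S i u).card := by
    rw [← Finset.card_union_of_disjoint t.dAR]
    refine le_trans (Finset.card_le_card ?_) (le_trans (Finset.card_union_le
      ((A \ nb c S i u) ∪ (R \ nb c S i u)) (nb c S i u)) ?_)
    · intro x
      simp only [Finset.mem_sdiff, Finset.mem_union]; tauto
    · have := Finset.card_union_le (A \ nb c S i u) (R \ nb c S i u)
      omega
  rcases t.cov u hu with h | h | h
  · have : R \ nb c S i u = ∅ := Finset.sdiff_eq_empty_iff_subset.mpr (t.R_sub h)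
    rw [this] at tot
    simp at tot
    omega
  · have : A \ nb c S i u = ∅ := Finset.sdiff_eq_empty_iff_subset.mpr (t.A_sub hs h)
    rw [this] at tot
    simp at tot
    omega
  · have : A \ nb c S i u = A := by
      apply Finset.sdiff_eq_self_of_disjoint
      rw [Finset.disjoint_left]
      intro x hx hx'
      have h1 := (mem_nb.mp hx').2.2
      rw [hs, t.hAB x hx u h] at h1
      exact t.ij h1.symm
    rw [this] at sA
    omega

set_option maxHeartbeats 1000000 in
lemma no_deg_n {V C : Type*} {c : V → V → C} (hs : IsSymm2 c) {n m : ℕ}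
    (hts : ¬ HasMonoTwoStars c n m) (hm : 5 ≤ m) (hmn : 6 * m + 8 ≤ n)
    {S : Finset V} {i j : C} (hij : i ≠ j) {E : V → V → Prop} (hE : Equivalence E)
    (h1 : ∀ x ∈ S, ∀ y ∈ S, ¬ E x y → c x y = i ∨ c x y = j)
    (h2 : ∀ x x' : V, ∀ z ∈ S, E x x' → ¬ E x z → c x z = c x' z)
    (h3 : ∃ x ∈ S, ∃ y ∈ S, ¬ E x y)
    (hF : 5 * n ≤ 2 * S.card + 6)
    (hi : ∀ v ∈ S, (nb c S i v).card ≤ n) (hj : ∀ v ∈ S, (nb c S j v).card ≤ n)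
    {u : V} : (nb c S i u).card ≠ n := by
  intro hdeg
  set P : V → Finset V := fun w => S.filter (fun y => E w y) with hP
  have memP : ∀ w y, y ∈ P w ↔ y ∈ S ∧ E w y := by intro w y; simp [hP]
  set W : Finset V := S \ insert u (nb c S i u) with hW
  have memW : ∀ w, w ∈ W ↔ w ∈ S ∧ w ≠ u ∧ w ∉ nb c S i u := by intro w; simp [hW]
  have hWc : S.card ≤ W.card + (n + 1) := by
    have := Finset.le_card_sdiff (insert u (nb c S i u)) S
    have h := Finset.card_insert_le u (nb c S i u)
    rw [← hW] at this
    omega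
  have hWred : ∀ w ∈ W, (nb c S i w \ nb c S i u).card < m := by
    intro w hw
    obtain ⟨hwS, hwu, hwn⟩ := (memW w).mp hw
    by_contra hlt
    push Not at hlt
    apply hts
    refine two_stars (i := i) hwu.symm (nb c S i u) (nb c S i w \ nb c S i u) ?_ ?_ hdeg.ge hlt ?_
    · intro x hx
      refine ⟨(mem_nb.mp hx).2.1, ?_, (mem_nb.mp hx).2.2⟩
      rintro rfl; exact hwn hx
    · intro x hx
      rw [Finset.mem_sdiff] at hx
      obtain ⟨a1, a2, a3⟩ := mem_nb.mp hx.1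
      refine ⟨?_, a2, a3⟩
      rintro rfl
      exact hwn (mem_nb.mpr ⟨hwS, hwu, by rw [hs]; exact a3⟩)
    · rw [Finset.card_union_of_disjoint Finset.disjoint_sdiff]; omega
  have hpart : ∀ w ∈ W, S.card ≤ (P w ∩ W).card + 2 * n + m := by
    intro w hw
    have hwS := ((memW w).mp hw).1
    have hsub : S ⊆ ((P w ∩ W) ∪ (insert u (nb c S i u))) ∪
        ((nb c S i w \ nb c S i u) ∪ nb c S j w) := by
      intro y hy
      by_cases hyw : E w y
      · simp only [Finset.mem_union, Finset.mem_inter, memP, memW, Finset.mem_insert]; tauto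
      · have hne : y ≠ w := by rintro rfl; exact hyw (hE.refl _)
        have := h1 w hwS y hy hyw
        simp only [Finset.mem_union, Finset.mem_sdiff, Finset.mem_insert]
        rw [@mem_nb V C c S i w, @mem_nb V C c S j w]
        tauto
    have := Finset.card_le_card hsub
    have e1 := Finset.card_union_le ((P w ∩ W) ∪ (insert u (nb c S i u)))
      ((nb c S i w \ nb c S i u) ∪ nb c S j w)
    have e2 := Finset.card_union_le (P w ∩ W) (insert u (nb c S i u))
    have e3 := Finset.card_union_le (nb c S i w \ nb c S i u) (nb c S j w)
    have e4 := Finset.card_insert_le u (nb c S i u)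
    have e5 := hWred w hw
    have e6 := hj w hwS
    omega
  have hblue : ∀ w ∈ W, ∀ w' ∈ W, ¬ E w w' → c w w' = j := by
    intro w hw w' hw' hn
    have hwS := ((memW w).mp hw).1
    have hwS' := ((memW w').mp hw').1
    rcases h1 w hwS w' hwS' hn with h | h
    · exfalso
      have : (P w ∩ W).card ≤ (nb c S i w' \ nb c S i u).card := by
        apply Finset.card_le_card
        intro y hy
        rw [Finset.mem_inter, memP, memW] at hy
        rw [Finset.mem_sdiff]
        refine ⟨mem_nb.mpr ⟨hy.1.1, ?_, ?_⟩, hy.2.2.2⟩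
        · rintro rfl; exact hn hy.1.2
        · rw [hs, ← h2 w y w' hwS' hy.1.2 hn, h]
      have e1 := hpart w hw
      have e2 := hWred w' hw'
      omega
    · exact h
  have hpart2 : ∀ w ∈ W, S.card ≤ (P w).card + 2 * n + 1 := by
    intro w hw
    have hwS := ((memW w).mp hw).1
    have hsub : S ⊆ (P w ∪ (insert u (nb c S i u))) ∪ nb c S j w := by
      intro y hy
      by_cases hyw : E w y
      · simp only [Finset.mem_union, memP]; tauto
      · have hne : y ≠ w := by rintro rfl; exact hyw (hE.refl _)
        by_cases hyW : y ∈ W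
        · have := hblue w hw y hyW hyw
          simp only [Finset.mem_union]
          right; exact mem_nb.mpr ⟨hy, hne, this⟩
        · rw [memW] at hyW
          simp only [Finset.mem_union, Finset.mem_insert]; tauto
    have := Finset.card_le_card hsub
    have e1 := Finset.card_union_le (P w ∪ (insert u (nb c S i u))) (nb c S j w)
    have e2 := Finset.card_union_le (P w) (insert u (nb c S i u))
    have e4 := Finset.card_insert_le u (nb c S i u)
    have e6 := hj w hwS
    omega
  have hPn : ∀ w ∈ S, (P w).card ≤ n := by
    intro w hw
    have t := tri_of_part hs hij hE h1 h2 hw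
    exact (t.bounds hs hi hj ⟨w, by simp [hw, hE.refl]⟩ (part_RB t hE rfl h3)).1
  have sub : ∀ x, ∀ w ∈ S, ∀ y ∈ S, ¬ E w y → c w y = x → P w ⊆ nb c S x y := by
    intro x w hw y hy hn hc z hz
    rw [memP] at hz
    refine mem_nb.mpr ⟨hz.1, ?_, ?_⟩
    · rintro rfl; exact hn hz.2
    · rw [hs, ← h2 w z y hy hz.2 hn, hc]
  have dis : ∀ w w', ¬ E w w' → Disjoint (P w) (P w') := by
    intro w w' h
    rw [Finset.disjoint_left]
    intro x hx hx'
    rw [memP] at hx hx'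
    exact h (hE.trans hx.2 (hE.symm hx'.2))
  have two : ∀ w ∈ W, ∀ w' ∈ W, ¬ E w w' → (P w).card + (P w').card ≤ n := by
    intro w hw w' hw' hn
    have hwS := ((memW w).mp hw).1
    have hwS' := ((memW w').mp hw').1
    have hb := hblue w hw w' hw' hn
    by_contra hcon
    have hsub : S ⊆ nb c S j w ∪ nb c S j w' := by
      intro y hy
      rw [Finset.mem_union]
      by_cases e1 : E w y
      · exact Or.inr (sub j w hwS w' hwS' hn hb ((memP w y).mpr ⟨hy, e1⟩))
      by_cases e2 : E w' y
      · exact Or.inl (sub j w' hwS' w hwS (fun h => hn (hE.symm h)) (by rw [hs, hb])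
          ((memP w' y).mpr ⟨hy, e2⟩))
      have n1 : y ≠ w := by rintro rfl; exact e1 (hE.refl _)
      have n2 : y ≠ w' := by rintro rfl; exact e2 (hE.refl _)
      by_contra hno
      have c1 : c w y = i := (h1 w hwS y hy e1).resolve_right
        (fun h => hno (Or.inl (mem_nb.mpr ⟨hy, n1, h⟩)))
      have c2 : c w' y = i := (h1 w' hwS' y hy e2).resolve_right
        (fun h => hno (Or.inr (mem_nb.mpr ⟨hy, n2, h⟩)))
      have := Finset.card_le_card (Finset.union_subset (sub i w hwS y hy e1 c1)
        (sub i w' hwS' y hy e2 c2))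
      rw [Finset.card_union_of_disjoint (dis w w' hn)] at this
      have := hi y hy
      omega
    have e0 := Finset.card_le_card hsub
    have e1 := Finset.card_union_le (nb c S j w) (nb c S j w')
    have e2 := hj w hwS
    have e3 := hj w' hwS'
    omega
  obtain ⟨w1, hw1⟩ := Finset.card_pos.mp (show 0 < W.card by omega)
  have hw1S := ((memW w1).mp hw1).1
  obtain ⟨w2, hw2, hw12⟩ : ∃ w2 ∈ W, w2 ∉ P w1 := by
    apply Finset.exists_mem_notMem_of_card_lt_card
    have := hPn w1 hw1S; omega
  have hw2S := ((memW w2).mp hw2).1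
  have n12 : ¬ E w1 w2 := by rw [memP] at hw12; tauto
  have t12 := two w1 hw1 w2 hw2 n12
  obtain ⟨w3, hw3, hw123⟩ : ∃ w3 ∈ W, w3 ∉ P w1 ∪ P w2 := by
    apply Finset.exists_mem_notMem_of_card_lt_card
    have := Finset.card_union_le (P w1) (P w2); omega
  have hw3S := ((memW w3).mp hw3).1
  rw [Finset.mem_union, memP, memP] at hw123
  have n13 : ¬ E w1 w3 := by tauto
  have n23 : ¬ E w2 w3 := by tauto
  have b12 := hblue w1 hw1 w2 hw2 n12
  have b13 := hblue w1 hw1 w3 hw3 n13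
  have b23 := hblue w2 hw2 w3 hw3 n23
  have s1 : P w1 ⊆ nb c S j w3 := sub j w1 hw1S w3 hw3S n13 b13
  have s2 : P w2 ⊆ nb c S j w3 := sub j w2 hw2S w3 hw3S n23 b23
  have g1 := hpart2 w1 hw1
  have g2 := hpart2 w2 hw2
  have g3 := hpart2 w3 hw3
  have hsub : S ⊆ (nb c S j w1 ∪ nb c S j w2) ∪ (nb c S j w3 \ (P w1 ∪ P w2)) := by
    intro y hy
    rw [Finset.mem_union, Finset.mem_union, Finset.mem_sdiff, Finset.mem_union]
    by_cases e1 : E w1 y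
    · exact Or.inl (Or.inr (sub j w1 hw1S w2 hw2S n12 b12 ((memP w1 y).mpr ⟨hy, e1⟩)))
    by_cases e2 : E w2 y
    · exact Or.inl (Or.inl (sub j w2 hw2S w1 hw1S (fun h => n12 (hE.symm h)) (by rw [hs, b12])
          ((memP w2 y).mpr ⟨hy, e2⟩)))
    by_cases e3 : E w3 y
    · exact Or.inl (Or.inl (sub j w3 hw3S w1 hw1S (fun h => n13 (hE.symm h)) (by rw [hs, b13])
          ((memP w3 y).mpr ⟨hy, e3⟩)))
    have m1 : y ≠ w1 := by rintro rfl; exact e1 (hE.refl _)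
    have m2 : y ≠ w2 := by rintro rfl; exact e2 (hE.refl _)
    have m3 : y ≠ w3 := by rintro rfl; exact e3 (hE.refl _)
    by_contra hno
    have c1 : c w1 y = i := (h1 w1 hw1S y hy e1).resolve_right
      (fun h => hno (Or.inl (Or.inl (mem_nb.mpr ⟨hy, m1, h⟩))))
    have c2 : c w2 y = i := (h1 w2 hw2S y hy e2).resolve_right
      (fun h => hno (Or.inl (Or.inr (mem_nb.mpr ⟨hy, m2, h⟩))))
    have c3 : c w3 y = i := (h1 w3 hw3S y hy e3).resolve_right
      (fun h => hno (Or.inr ⟨mem_nb.mpr ⟨hy, m3, h⟩, fun hh => hh.elim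
        (fun h' => e1 ((memP _ _).mp h').2) (fun h' => e2 ((memP _ _).mp h').2)⟩))
    have := Finset.card_le_card (Finset.union_subset (Finset.union_subset
      (sub i w1 hw1S y hy e1 c1) (sub i w2 hw2S y hy e2 c2))
      (sub i w3 hw3S y hy e3 c3))
    rw [Finset.card_union_of_disjoint (Finset.disjoint_union_left.mpr ⟨dis _ _ n13, dis _ _ n23⟩),
      Finset.card_union_of_disjoint (dis _ _ n12)] at this
    have := hi y hy
    omega
  have f0 := Finset.card_le_card hsub
  have f1 := Finset.card_union_le (nb c S j w1 ∪ nb c S j w2) (nb c S j w3 \ (P w1 ∪ P w2))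
  have f2 := Finset.card_union_le (nb c S j w1) (nb c S j w2)
  have f3 := Finset.card_sdiff_add_card_eq_card (Finset.union_subset s1 s2)
  rw [Finset.card_union_of_disjoint (dis _ _ n12)] at f3
  have q1 := hj w1 hw1S
  have q2 := hj w2 hw2S
  have q3 := hj w3 hw3S
  omega

/-- Claim 1: the main configuration cannot occur at full size. -/
lemma claim_one {V C : Type*} {c : V → V → C} (hs : IsSymm2 c) {n m f : ℕ}
    (hts : ¬ HasMonoTwoStars c n m) (hm : 5 ≤ m) (hmn : 6 * m + 8 ≤ n)
    (hf : (n % 2 = 0 ∧ 2 * f + 6 = 5 * n) ∨ (n % 2 = 1 ∧ 2 * f + 3 = 5 * n))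
    {S : Finset V} {i j : C} (hij : i ≠ j) {E : V → V → Prop} (hE : Equivalence E)
    (h1 : ∀ x ∈ S, ∀ y ∈ S, ¬ E x y → c x y = i ∨ c x y = j)
    (h2 : ∀ x x' : V, ∀ z ∈ S, E x x' → ¬ E x z → c x z = c x' z)
    (h3 : ∃ x ∈ S, ∃ y ∈ S, ¬ E x y)
    (hF : f ≤ S.card)
    (hi : ∀ v ∈ S, (nb c S i v).card ≤ n) (hj : ∀ v ∈ S, (nb c S j v).card ≤ n) : False := by
  have hi' : ∀ v ∈ S, (nb c S i v).card ≤ n - 1 := by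
    intro v hv
    have e1 := no_deg_n hs hts hm hmn hij hE h1 h2 h3 (by omega) hi hj (u := v)
    have e2 := hi v hv
    omega
  have hj' : ∀ v ∈ S, (nb c S j v).card ≤ n - 1 := by
    intro v hv
    have e1 := no_deg_n hs hts hm hmn hij.symm hE (fun x hx y hy h => (h1 x hx y hy h).symm)
      h2 h3 (by omega) hj hi (u := v)
    have e2 := hj v hv
    omega
  obtain ⟨d, rfl⟩ : ∃ d, n = d + 1 := ⟨n - 1, by omega⟩
  simp only [Nat.add_sub_cancel] at hi' hj'
  have hsz : ∀ w ∈ S, 2 * (S.filter (fun y => E w y)).card + 1 = d ∧ 2 * S.card + 1 = 5 * d := by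
    intro w hw
    have t := tri_of_part hs hij hE h1 h2 hw
    obtain ⟨g1, g2, g3, g4, g5⟩ := t.bounds hs hi' hj' ⟨w, by simp [hw, hE.refl]⟩ (part_RB t hE rfl h3)
    have hc := t.card
    rcases hf with hf | hf
    · refine ⟨?_, by omega⟩
      by_contra hne
      have ha : 2 * (S.filter (fun y => E w y)).card = d + 1 := by omega
      have hs' : (S.filter (fun y => ¬ E w y ∧ c w y = i)).card +
        (S.filter (fun y => ¬ E w y ∧ c w y = j)).card + 1 = 2 * d := by omega
      clear g1 g2 g3 g5 hc hne t
      generalize (S.filter (fun y => E w y)).card = a at *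
      generalize (S.filter (fun y => ¬ E w y ∧ c w y = i)).card +
        (S.filter (fun y => ¬ E w y ∧ c w y = j)).card = s at *
      nlinarith
    · omega
  obtain ⟨w, hw, -⟩ := id h3
  obtain ⟨q, hq⟩ : ∃ q, d = 2 * q + 1 := ⟨(S.filter (fun y => E w y)).card, by
    have := (hsz w hw).1; omega⟩
  have hfib : S.card = ∑ b ∈ S.image (fun w => S.filter (fun y => E w y)), q := by
    rw [Finset.card_eq_sum_card_image (fun w => S.filter (fun y => E w y)) S]
    apply Finset.sum_congr rfl
    intro b hb
    obtain ⟨x, hx, rfl⟩ := Finset.mem_image.mp hb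
    have : S.filter (fun a => S.filter (fun y => E a y) = S.filter (fun y => E x y))
        = S.filter (fun y => E x y) := by
      apply Finset.filter_congr
      intro a ha
      constructor
      · intro h
        have : a ∈ S.filter (fun y => E a y) := by simp [ha, hE.refl]
        rw [h] at this
        exact (Finset.mem_filter.mp this).2
      · intro h
        apply Finset.filter_congr
        intro y _
        exact ⟨fun h' => hE.trans h h', fun h' => hE.trans (hE.symm h) h'⟩
    rw [this]
    have := (hsz x hx).1
    omega
  rw [Finset.sum_const, smul_eq_mul] at hfib
  have h5 := (hsz w hw).2
  generalize (S.image (fun w => S.filter (fun y => E w y))).card = tt at hfib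
  have h6 : tt * q = 5 * q + 2 := by omega
  have h7 : q ∣ 2 := by
    have : q ∣ 5 * q + 2 := ⟨tt, by rw [← h6, mul_comm]⟩
    exact (Nat.dvd_add_right (Dvd.intro_left 5 rfl)).mp this
  have := Nat.le_of_dvd (by norm_num) h7
  omega

/-- Claim 2: one fewer vertex, all other colours low. -/
lemma claim_two {V C : Type*} [Nontrivial C] {c : V → V → C} (hs : IsSymm2 c) (hr : NoRb c)
    {n m : ℕ} (hm : 5 ≤ m) (hmn : 6 * m + 8 ≤ n)
    {S A R B : Finset V} {i j : C} (t : Tri c S A R B i j)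
    (hF : 5 * n ≤ 2 * S.card + 8) (hA : A.Nonempty) (hRB : 1 ≤ R.card + B.card)
    (hi : ∀ v ∈ S, (nb c S i v).card ≤ n) (hj : ∀ v ∈ S, (nb c S j v).card ≤ n)
    (hL : ∀ x, x ≠ i → x ≠ j → ∀ v ∈ S, (nb c S x v).card < m) : False := by
  obtain ⟨g1, g2, g3, g4, g5⟩ := t.bounds hs hi hj hA hRB
  have hc := t.card
  have half : ∀ {S A R B : Finset V} {i j : C}, Tri c S A R B i j →
      (∀ v ∈ S, (nb c S i v).card ≤ n) → ∀ v ∈ A, (nb c A i v).card + R.card ≤ n := by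
    intro S A R B i j t hi v hv
    refine le_trans ?_ (hi v (t.AS hv))
    rw [← Finset.card_union_of_disjoint]
    · apply Finset.card_le_card
      apply Finset.union_subset _ (t.R_sub hv)
      intro x hx
      rw [mem_nb] at hx ⊢
      exact ⟨t.AS hx.1, hx.2⟩
    · exact Finset.disjoint_of_subset_left (Finset.filter_subset _ _) t.dAR
  have key := star_bound hs hr A (by omega) (max (m - 1) (max (n - R.card) (n - B.card))) (by
    intro x v hv
    by_cases hxi : x = i
    · subst hxi
      have := half t hi v hv
      omega
    by_cases hxj : x = j
    · subst hxj
      have := half (t.swap hs) hj v hv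
      omega
    have e1 := hL x hxi hxj v (t.AS hv)
    have e2 : (nb c A x v).card ≤ (nb c S x v).card :=
      Finset.card_le_card (Finset.filter_subset_filter _ t.AS)
    omega)
  omega

lemma heavy {V C : Type*} {c : V → V → C} {n m : ℕ}
    (hts : ¬ HasMonoTwoStars c n m) {S : Finset V} {x : C} {u v : V} (huv : u ≠ v)
    (h1 : n + m + 1 ≤ (nb c S x u).card) (h2 : m + 1 ≤ (nb c S x v).card) : False := by
  apply hts
  have e1 := Finset.pred_card_le_card_erase (s := nb c S x u) (a := v)
  have e2 := Finset.pred_card_le_card_erase (s := nb c S x v) (a := u)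
  refine two_stars (i := x) huv ((nb c S x u).erase v) ((nb c S x v).erase u) ?_ ?_ ?_ ?_ ?_
  · intro y hy
    rw [Finset.mem_erase, mem_nb] at hy; tauto
  · intro y hy
    rw [Finset.mem_erase, mem_nb] at hy; tauto
  · omega
  · omega
  · have := Finset.card_le_card (Finset.subset_union_left (s₁ := (nb c S x u).erase v)
      (s₂ := (nb c S x v).erase u))
    omega

lemma big_part {V C : Type*} {c : V → V → C} (hs : IsSymm2 c) {n m : ℕ}
    (hts : ¬ HasMonoTwoStars c n m)
    {S : Finset V} (h4 : 4 ≤ S.card) {i j : C} (hij : i ≠ j)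
    (hd : ∀ v ∈ S, n + m + 1 ≤ (nb c S i v).card ∨ n + m + 1 ≤ (nb c S j v).card ∨
      ((nb c S i v).card = n + m ∧ (nb c S j v).card = n + m)) : False := by
  have one : ∀ x, (S.filter (fun v => n + m + 1 ≤ (nb c S x v).card)).card ≤ 1 := by
    intro x
    by_contra h
    push Not at h
    obtain ⟨u, hu, v, hv, huv⟩ := Finset.one_lt_card.mp h
    simp only [Finset.mem_filter] at hu hv
    exact heavy hts huv hu.2 (by omega)
  have h5 : 1 < (S \ (S.filter (fun v => n + m + 1 ≤ (nb c S i v).card) ∪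
      S.filter (fun v => n + m + 1 ≤ (nb c S j v).card))).card := by
    have e1 := one i
    have e2 := one j
    have e3 := Finset.card_union_le (S.filter (fun v => n + m + 1 ≤ (nb c S i v).card))
      (S.filter (fun v => n + m + 1 ≤ (nb c S j v).card))
    have e4 := Finset.le_card_sdiff (S.filter (fun v => n + m + 1 ≤ (nb c S i v).card) ∪
      S.filter (fun v => n + m + 1 ≤ (nb c S j v).card)) S
    omega
  obtain ⟨u, hu, v, hv, huv⟩ := Finset.one_lt_card.mp h5
  simp only [Finset.mem_sdiff, Finset.mem_union, Finset.mem_filter] at hu hv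
  have du := hd u hu.1
  have dv := hd v hv.1
  have fin : ∀ x, (nb c S x u).card = n + m → (nb c S x v).card = n + m → c u v ≠ x → False := by
    intro x e1 e2 hne
    apply hts
    refine two_stars (i := x) huv (nb c S x u) (nb c S x v) ?_ ?_ ?_ ?_ ?_
    · intro y hy
      rw [mem_nb] at hy
      refine ⟨hy.2.1, ?_, hy.2.2⟩
      rintro rfl; exact hne hy.2.2
    · intro y hy
      rw [mem_nb] at hy
      refine ⟨?_, hy.2⟩
      rintro rfl; rw [hs] at hne; exact hne hy.2.2
    · omega
    · omega
    · have := Finset.card_le_card (Finset.subset_union_left (s₁ := nb c S x u)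
        (s₂ := nb c S x v))
      omega
  have du' : (nb c S i u).card = n + m ∧ (nb c S j u).card = n + m := by tauto
  have dv' : (nb c S i v).card = n + m ∧ (nb c S j v).card = n + m := by tauto
  by_cases h : c u v = i
  · exact fin j du'.2 dv'.2 (by rw [h]; exact hij)
  · exact fin i du'.1 dv'.1 h

/-- In a homogeneous configuration with `|A| > m`, `|R| ≤ n`. -/
lemma R_le {V C : Type*} {c : V → V → C} (hs : IsSymm2 c) {n m : ℕ}
    (hts : ¬ HasMonoTwoStars c n m) {X Y : Finset V} {i : C} (hd : Disjoint X Y)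
    (h : ∀ x ∈ X, ∀ y ∈ Y, c x y = i) (hX : m + 1 ≤ X.card) : Y.card ≤ n := by
  by_contra hY
  push Not at hY
  obtain ⟨u, hu⟩ := Finset.card_pos.mp (show 0 < X.card by omega)
  obtain ⟨v, hv⟩ := Finset.card_pos.mp (show 0 < Y.card by omega)
  have hd' := Finset.disjoint_left.mp hd
  have e1 := Finset.card_erase_of_mem hu
  have e2 := Finset.card_erase_of_mem hv
  apply hts
  refine two_stars (i := i) (u := u) (v := v) ?_ (Y.erase v) (X.erase u) ?_ ?_ ?_ ?_ ?_
  · rintro rfl; exact hd' hu hv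
  · intro x hx
    rw [Finset.mem_erase] at hx
    refine ⟨?_, hx.1, h u hu x hx.2⟩
    rintro rfl; exact hd' hu hx.2
  · intro x hx
    rw [Finset.mem_erase] at hx
    refine ⟨hx.1, ?_, by rw [hs]; exact h x hx.2 v hv⟩
    rintro rfl; exact hd' hx.2 hv
  · omega
  · omega
  · rw [Finset.card_union_of_disjoint]
    · omega
    · exact (Finset.disjoint_of_subset_left (Finset.erase_subset _ _)
        (Finset.disjoint_of_subset_right (Finset.erase_subset _ _) hd)).symm

lemma two_le {V C : Type*} {c : V → V → C} {n m : ℕ}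
    (hts : ¬ HasMonoTwoStars c n m) {X Y : Finset V} {i : C} (hd : Disjoint X Y)
    (h : ∀ x ∈ X, ∀ y ∈ Y, c x y = i) (hX : 2 ≤ X.card) : Y.card < n + m := by
  by_contra hY
  push Not at hY
  obtain ⟨u, hu, v, hv, huv⟩ := Finset.one_lt_card.mp (show 1 < X.card by omega)
  have hd' := Finset.disjoint_left.mp hd
  have hne : ∀ w ∈ X, ∀ y ∈ Y, y ≠ w := by rintro w hw y hy rfl; exact hd' hw hy
  apply hts
  refine two_stars (i := i) (u := u) (v := v) huv Y Y ?_ ?_ ?_ ?_ ?_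
  · exact fun y hy => ⟨hne u hu y hy, hne v hv y hy, h u hu y hy⟩
  · exact fun y hy => ⟨hne u hu y hy, hne v hv y hy, h v hv y hy⟩
  · omega
  · omega
  · rw [Finset.union_self]; omega

lemma core {V C : Type*} [Fintype C] [Nontrivial C] {c : V → V → C} (hs : IsSymm2 c)
    (hr : NoRb c) {n m f k : ℕ}
    (hts : ¬ HasMonoTwoStars c n m) (hm : 5 ≤ m) (hmn : 6 * m + 8 ≤ n)
    (hf : (n % 2 = 0 ∧ 2 * f + 6 = 5 * n) ∨ (n % 2 = 1 ∧ 2 * f + 3 = 5 * n))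
    (hk : Fintype.card C = k) :
    ∀ (F : ℕ) (S : Finset V) (L : Finset C), S.card = F →
      (∀ x ∈ L, ∀ v ∈ S, (nb c S x v).card < m) → f + k ≤ F + L.card + 3 → False := by
  intro F
  induction F with
  | zero =>
    intro S L _ _ h
    have := Finset.card_le_univ L
    omega
  | succ F ih =>
  intro S L hSF hL hFL
  have hLk := Finset.card_le_univ L
  rw [hk] at hLk
  obtain ⟨i, j, hij, E, hE, h1, h2, h3⟩ := gallai_partition hs hr S (by omega)
  have hLij : i ∉ L → j ∉ L → L.card + 2 ≤ k ∧
      (L.card + 2 = k → ∀ x, x ≠ i → x ≠ j → x ∈ L) := by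
    intro hi hj
    have e : (insert i (insert j L)).card = L.card + 2 := by
      rw [Finset.card_insert_of_notMem, Finset.card_insert_of_notMem hj]
      simp [hij, hi]
    have e2 := Finset.card_le_univ (insert i (insert j L))
    refine ⟨by omega, ?_⟩
    intro e3 x hxi hxj
    have : insert i (insert j L) = Finset.univ := by
      rw [← Finset.card_eq_iff_eq_univ]; omega
    have hx : x ∈ insert i (insert j L) := by rw [this]; simp
    simp only [Finset.mem_insert] at hx
    tauto
  -- a big part exists
  obtain ⟨w, hw, hbig⟩ : ∃ w ∈ S, m + 1 ≤ (S.filter (fun y => E w y)).card := by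
    by_contra hno
    push Not at hno
    refine big_part hs hts (by omega) hij (n := n) (m := m) (S := S) ?_
    intro v hv
    have t := tri_of_part hs hij hE h1 h2 hv
    have hc := t.card
    have hvA : v ∈ S.filter (fun y => E v y) := by simp [hv, hE.refl]
    have e1 := Finset.card_le_card (t.R_sub hvA)
    have e2 := Finset.card_le_card ((t.swap hs).R_sub hvA)
    have e3 := hno v hv
    by_cases hi : i ∈ L
    · have := hL i hi v hv
      right; left; omega
    by_cases hj : j ∈ L
    · have := hL j hj v hv
      left; omega
    have := (hLij hi hj).1
    omega
  have t := tri_of_part hs hij hE h1 h2 hw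
  have hRB := part_RB t hE rfl h3
  have hAne : (S.filter (fun y => E w y)).Nonempty := ⟨w, by simp [hw, hE.refl]⟩
  generalize S.filter (fun y => E w y) = A at *
  generalize S.filter (fun y => ¬ E w y ∧ c w y = i) = R at *
  generalize S.filter (fun y => ¬ E w y ∧ c w y = j) = B at *
  have hc := t.card
  have hRA : ∀ x ∈ R, ∀ y ∈ A, c x y = i := fun x hx y hy => by rw [hs]; exact t.hAR y hy x hx
  have hBA : ∀ x ∈ B, ∀ y ∈ A, c x y = j := fun x hx y hy => by rw [hs]; exact t.hAB y hy x hx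
  have r1 : R.card ≤ n := R_le hs hts t.dAR t.hAR hbig
  have b1 : B.card ≤ n := R_le hs hts t.dAB t.hAB hbig
  by_cases hcase : m + 1 ≤ R.card ∨ m + 1 ≤ B.card
  · have a1 : A.card ≤ n := by
      rcases hcase with h | h
      · exact R_le hs hts t.dAR.symm hRA h
      · exact R_le hs hts t.dAB.symm hBA h
    obtain ⟨v, hv⟩ := id hAne
    have hiL : i ∉ L := by
      intro h
      have e1 := hL i h v (t.AS hv)
      have e2 := Finset.card_le_card (t.R_sub hv)
      omega
    have hjL : j ∉ L := by
      intro h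
      have e1 := hL j h v (t.AS hv)
      have e2 := Finset.card_le_card ((t.swap hs).R_sub hv)
      omega
    obtain ⟨k1, k2⟩ := hLij hiL hjL
    have di : ∀ v ∈ S, (nb c S i v).card ≤ n := fun u hu =>
      deg_le hs hts hm hmn t (by omega) a1 r1 b1 hu
    have dj : ∀ v ∈ S, (nb c S j v).card ≤ n := fun u hu =>
      deg_le hs hts hm hmn (t.swap hs) (by omega) a1 b1 r1 hu
    by_cases hk2 : L.card + 2 = k
    · exact claim_two hs hr hm hmn t (by omega) hAne hRB di dj
        (fun x hxi hxj v hv => hL x (k2 hk2 x hxi hxj) v hv)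
    · exact claim_one hs hts hm hmn hf hij hE h1 h2 h3 (by omega) di dj
  · push Not at hcase
    have rs : R.card ≤ 1 := by
      by_contra h
      have := two_le hts t.dAR.symm hRA (by omega)
      omega
    have bs : B.card ≤ 1 := by
      by_contra h
      have := two_le hts t.dAB.symm hBA (by omega)
      omega
    obtain ⟨x, z, hz, hzz⟩ : ∃ x : C, ∃ z ∈ S, ∀ y ∈ S, y ≠ z → c z y = x := by
      rcases R.eq_empty_or_nonempty with hR | ⟨p, hp⟩
      · obtain ⟨q, hq⟩ := Finset.card_eq_one.mp (show B.card = 1 by rw [hR, Finset.card_empty] at hRB; omega)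
        refine ⟨j, q, t.BS (by simp [hq]), ?_⟩
        intro y hy hne
        rcases t.cov y hy with h | h | h
        · exact hBA q (by simp [hq]) y h
        · simp [hR] at h
        · simp [hq] at h; exact absurd h hne
      · have hR1 : ∀ y ∈ R, y = p := fun y hy => Finset.card_le_one.mp rs y hy p hp
        rcases B.eq_empty_or_nonempty with hB | ⟨q, hq⟩
        · refine ⟨i, p, t.RS hp, ?_⟩
          intro y hy hne
          rcases t.cov y hy with h | h | h
          · exact hRA p hp y h
          · exact absurd (hR1 y h) hne
          · simp [hB] at h
        · have hB1 : ∀ y ∈ B, y = q := fun y hy => Finset.card_le_one.mp bs y hy q hq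
          rcases t.hRB p hp q hq with hpq | hpq
          · refine ⟨i, p, t.RS hp, ?_⟩
            intro y hy hne
            rcases t.cov y hy with h | h | h
            · exact hRA p hp y h
            · exact absurd (hR1 y h) hne
            · rw [hB1 y h, hpq]
          · refine ⟨j, q, t.BS hq, ?_⟩
            intro y hy hne
            rcases t.cov y hy with h | h | h
            · exact hBA q hq y h
            · rw [hR1 y h, hs, hpq]
            · exact absurd (hB1 y h) hne
    have hnz : (nb c S x z).card = F := by
      have : nb c S x z = S.erase z := by
        ext y
        rw [mem_nb, Finset.mem_erase]
        have := hzz y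
        tauto
      rw [this, Finset.card_erase_of_mem hz]; omega
    have hxL : x ∉ L := by
      intro h
      have := hL x h z hz
      omega
    refine ih (S.erase z) (insert x L) ?_ ?_ ?_
    · rw [Finset.card_erase_of_mem hz]; omega
    · intro y hy v hv
      rw [Finset.mem_erase] at hv
      rw [Finset.mem_insert] at hy
      rcases hy with rfl | hy
      · by_contra hge
        push Not at hge
        apply heavy hts (S := S) (x := y) (u := z) (v := v) hv.1.symm (by omega)
        have hzn : z ∉ nb c (S.erase z) y v := by
          rw [mem_nb]; simp
        have : insert z (nb c (S.erase z) y v) ⊆ nb c S y v := by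
          intro a ha
          rw [Finset.mem_insert, mem_nb, Finset.mem_erase] at ha
          rw [mem_nb]
          rcases ha with rfl | ha
          · exact ⟨hz, hv.1.symm, by rw [hs]; exact hzz v hv.2 hv.1⟩
          · tauto
        have := Finset.card_le_card this
        rw [Finset.card_insert_of_notMem hzn] at this
        omega
      · have e1 := hL y hy v hv.2
        have e2 : (nb c (S.erase z) y v).card ≤ (nb c S y v).card :=
          Finset.card_le_card (Finset.filter_subset_filter _ (Finset.erase_subset _ _))
        omega
    · rw [Finset.card_insert_of_notMem hxL]; omega

/-- Colour classes of the lower-bound colouring, with `s` special vertices. -/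
def colN (s x y : ℕ) : ℕ :=
  if min x y < s then 3 + min x y
  else if x < y then
    (if (y - x) % 5 = 0 then 2 else if (y - x) % 5 = 1 ∨ (y - x) % 5 = 4 then 0 else 1)
  else
    (if (x - y) % 5 = 0 then 2 else if (x - y) % 5 = 1 ∨ (x - y) % 5 = 4 then 0 else 1)

lemma colN_symm (s x y : ℕ) : colN s x y = colN s y x := by
  unfold colN
  rw [min_comm]
  split_ifs <;> first | rfl | omega

lemma colN_lt (k x y : ℕ) (hk : 3 ≤ k) : colN (k - 3) x y < k := by
  unfold colN
  split_ifs <;> omega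

lemma colN_rb (s x y z : ℕ) :
    colN s x y = colN s x z ∨ colN s x y = colN s y z ∨ colN s x z = colN s y z := by
  by_cases hx : min x (min y z) < s
  · unfold colN
    have hc : (x ≤ y ∧ x ≤ z) ∨ (y ≤ x ∧ y ≤ z) ∨ (z ≤ x ∧ z ≤ y) := by omega
    rcases hc with h | h | h
    · left
      rw [if_pos (show min x y < s by omega), if_pos (show min x z < s by omega)]
      omega
    · right; left
      rw [if_pos (show min x y < s by omega), if_pos (show min y z < s by omega)]
      omega
    · right; right
      rw [if_pos (show min x z < s by omega), if_pos (show min y z < s by omega)]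
      omega
  · have e1 : ¬ min x y < s := by omega
    have e2 : ¬ min x z < s := by omega
    have e3 : ¬ min y z < s := by omega
    unfold colN
    rw [if_neg e1, if_neg e2, if_neg e3]
    split_ifs <;> omega

lemma colN_deg (s q M e : ℕ) (he : e ≤ 1) (hM : M ≤ s + 5 * q + e) (u i : ℕ) (hu : s ≤ u)
    (hi : i < 3) (T : Finset ℕ) (hT : ∀ y ∈ T, y < M ∧ colN s u y = i) :
    T.card ≤ 2 * q + e := by
  obtain ⟨r1, r2, hr⟩ : ∃ r1 r2 : ℕ, ∀ y ∈ T, s ≤ y ∧ ((y - s) % 5 = r1 ∨ (y - s) % 5 = r2) := by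
    have hsy : ∀ y ∈ T, s ≤ y := by
      intro y hy
      have h := (hT y hy).2
      by_contra hlt
      unfold colN at h
      rw [if_pos (by omega)] at h
      omega
    have hh : ∀ y ∈ T, s ≤ y ∧ colN s u y = i := fun y hy => ⟨hsy y hy, (hT y hy).2⟩
    interval_cases i
    · refine ⟨(u - s + 1) % 5, (u - s + 4) % 5, fun y hy => ?_⟩
      obtain ⟨a, b⟩ := hh y hy
      refine ⟨a, ?_⟩
      unfold colN at b
      split_ifs at b <;> omega
    · refine ⟨(u - s + 2) % 5, (u - s + 3) % 5, fun y hy => ?_⟩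
      obtain ⟨a, b⟩ := hh y hy
      refine ⟨a, ?_⟩
      unfold colN at b
      split_ifs at b <;> omega
    · refine ⟨(u - s) % 5, (u - s) % 5, fun y hy => ?_⟩
      obtain ⟨a, b⟩ := hh y hy
      refine ⟨a, ?_⟩
      unfold colN at b
      split_ifs at b <;> omega
  have hsub : T.image (fun y => ((y - s) / 5, (y - s) % 5)) ⊆
      (Finset.range q ×ˢ {r1, r2}) ∪ (if e = 0 then ∅ else {(q, 0)}) := by
    intro p hp
    obtain ⟨y, hy, rfl⟩ := Finset.mem_image.mp hp
    have a1 := (hT y hy).1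
    have a2 := hr y hy
    simp only [Finset.mem_union, Finset.mem_product, Finset.mem_range, Finset.mem_insert,
      Finset.mem_singleton]
    by_cases hq : (y - s) / 5 < q
    · left; exact ⟨hq, a2.2⟩
    · right
      rw [if_neg (by omega)]
      rw [Finset.mem_singleton, Prod.mk.injEq]
      omega
  have hinj : (T.image (fun y => ((y - s) / 5, (y - s) % 5))).card = T.card := by
    apply Finset.card_image_of_injOn
    intro y hy y' hy' h
    have a1 := (hr y hy).1
    have a2 := (hr y' hy').1
    simp only [Prod.mk.injEq] at h
    omega
  rw [← hinj]
  refine (Finset.card_le_card hsub).trans ((Finset.card_union_le _ _).trans ?_)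
  rw [Finset.card_product, Finset.card_range]
  have h2 : ({r1, r2} : Finset ℕ).card ≤ 2 := Finset.card_le_two
  have h3 : ((if e = 0 then ∅ else {(q, 0)}) : Finset (ℕ × ℕ)).card ≤ e := by
    split_ifs
    · simp
    · simp; omega
  nlinarith

lemma lower (k n m q e N : ℕ) (hk : 3 ≤ k) (hn : 2 ≤ n) (hm : 2 ≤ m) (he : e ≤ 1)
    (hq : 2 * q + e < n) (hN : N ≤ (k - 3) + 5 * q + e) :
    ∃ c : Fin N → Fin N → Fin k, IsSymm2 c ∧ ¬ HasRainbowTriangle c ∧ ¬ HasMonoTwoStars c n m := by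
  refine ⟨fun x y => ⟨colN (k - 3) x y, colN_lt k x y hk⟩, ?_, ?_, ?_⟩
  · intro a b
    simp only [Fin.mk.injEq]
    exact colN_symm _ _ _
  · rintro ⟨a, b, d, -, -, -, h1, h2, h3⟩
    simp only [ne_eq, Fin.mk.injEq] at h1 h2 h3
    have := colN_rb (k - 3) a b d
    tauto
  · rintro ⟨i, u, v, S, T, huv, hS, hT, -, huS, -, -, hvT, h1, h2⟩
    have h1' : ∀ x ∈ S, colN (k - 3) u x = i := fun x hx => by rw [← h1 x hx]
    have h2' : ∀ x ∈ T, colN (k - 3) v x = i := fun x hx => by rw [← h2 x hx]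
    by_cases hi : (i : ℕ) < 3
    · have hu : k - 3 ≤ (u : ℕ) := by
        obtain ⟨x, hx⟩ := Finset.card_pos.mp (show 0 < S.card by omega)
        have h := h1' x hx
        by_contra hlt
        unfold colN at h
        rw [if_pos (by omega)] at h
        omega
      have := colN_deg (k - 3) q N e he hN u i hu hi (S.map Fin.valEmbedding) (by
        intro y hy
        obtain ⟨x, hx, rfl⟩ := Finset.mem_map.mp hy
        exact ⟨x.2, h1' x hx⟩)
      rw [Finset.card_map] at this
      omega
    · have cen : ∀ (w : Fin N) (X : Finset (Fin N)), 2 ≤ X.card →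
          (∀ x ∈ X, colN (k - 3) w x = i) → (w : ℕ) + 3 = i := by
        intro w X hX hc
        by_contra hne
        have : ∀ x ∈ X, (x : ℕ) + 3 = i := by
          intro x hx
          have h := hc x hx
          unfold colN at h
          split_ifs at h <;> omega
        have : X.card ≤ 1 := by
          rw [Finset.card_le_one]
          intro a ha b hb
          have e1 := this a ha
          have e2 := this b hb
          exact Fin.ext (by omega)
        omega
      have e1 := cen u S (by omega) h1'
      have e2 := cen v T (by omega) h2'
      exact huv (Fin.ext (by omega))

end Helpers

/-- For `n ≥ 22`, `m ≥ 5`, `k ≥ 3` with `m ≤ (n-8)/6`,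
`gr_k(K_3 : K_{1,n} ∪ K_{1,m}) = (5n-6)/2 + k - 3` if `n` even, `(5n-3)/2 + k - 3` if `n` odd. -/
theorem grk_union_stars_small_m (k n m : ℕ) (hn : 22 ≤ n) (hm : 5 ≤ m) (hk : 3 ≤ k)
    (hmn : 6 * m + 8 ≤ n) :
    IsLeast {N : ℕ | ∀ c : Fin N → Fin N → Fin k, IsSymm2 c →
        HasRainbowTriangle c ∨ HasMonoTwoStars c n m}
      (if Even n then (5 * n - 6) / 2 + k - 3 else (5 * n - 3) / 2 + k - 3) := by
  obtain ⟨f, hf, hval⟩ : ∃ f, ((n % 2 = 0 ∧ 2 * f + 6 = 5 * n) ∨ (n % 2 = 1 ∧ 2 * f + 3 = 5 * n)) ∧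
      (if Even n then (5 * n - 6) / 2 + k - 3 else (5 * n - 3) / 2 + k - 3) = f + k - 3 := by
    by_cases h : Even n
    · rw [if_pos h]
      rw [Nat.even_iff] at h
      exact ⟨(5 * n - 6) / 2, by omega, rfl⟩
    · rw [if_neg h]
      rw [Nat.even_iff] at h
      exact ⟨(5 * n - 3) / 2, by omega, rfl⟩
  rw [hval]
  constructor
  · intro c hs
    by_contra hcon
    push Not at hcon
    obtain ⟨hrb, hts⟩ := hcon
    have hr : NoRb c := by
      intro a b d h1 h2 h3
      by_contra h
      push Not at h
      exact hrb ⟨a, b, d, h1, h2, h3, h.1, h.2.1, h.2.2⟩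
    haveI : Nontrivial (Fin k) := Fin.nontrivial_iff_two_le.mpr (by omega)
    refine core hs hr hts hm hmn hf (Fintype.card_fin k) _ Finset.univ ∅ rfl (by simp) ?_
    simp
    omega
  · intro N hN
    by_contra hlt
    push Not at hlt
    obtain ⟨q, e, he, hq, hN'⟩ : ∃ q e, e ≤ 1 ∧ 2 * q + e < n ∧ N ≤ (k - 3) + 5 * q + e := by
      rcases hf with hf | hf
      · exact ⟨(n - 2) / 2, 1, le_rfl, by omega, by omega⟩
      · exact ⟨(n - 1) / 2, 0, by omega, by omega, by omega⟩
    obtain ⟨c, c1, c2, c3⟩ := lower k n m q e N hk (by omega) (by omega) he hq hN'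
    rcases hN c c1 with h | h
    · exact c2 h
    · exact c3 h
end
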